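/- Let χ > 0 and suppose (B) and (init) are fulfilled, and assume hypothesis (H2) holds. Then there exists C > 0 such that the global classical solution (u, v) of the crime model satisfies u(x,t) ≤ C for all x ∈ Ω and t > 0, and 1/C ≤ v(x,t) ≤ C for all x ∈ Ω and t > 0. If additionally hypothesis (H1') is valid, then ‖u(·,t)‖_{L^∞(Ω)} → 0 as t → ∞. -/

import Mathlib

open Real MeasureTheory Filter Topology Set
open scoped ENNReal NNReal

noncomputable section

/-- Partial derivative of a space-time function in the first (space) variable. -/
def pdx (f : ℝ → ℝ → ℝ) : ℝ → ℝ → ℝ := fun x t => deriv (fun y => f y t) x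

/-- Partial derivative of a space-time function in the second (time) variable. -/
def pdt (f : ℝ → ℝ → ℝ) : ℝ → ℝ → ℝ := fun x t => deriv (fun s => f x s) t

/-- The time interval `[0, Tmax)` (with `Tmax ∈ (0,∞]`). -/
def It (Tmax : ℝ≥0∞) : Set ℝ := {t : ℝ | 0 ≤ t ∧ ENNReal.ofReal t < Tmax}

/-- The time interval `(0, Tmax)` (with `Tmax ∈ (0,∞]`). -/
def It' (Tmax : ℝ≥0∞) : Set ℝ := {t : ℝ | 0 < t ∧ ENNReal.ofReal t < Tmax}

/-- The waiting time `τ := min{1, Tmax/3}`, as a real number. -/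
def tauOf (Tmax : ℝ≥0∞) : ℝ := (min 1 (Tmax / 3)).toReal

/-- Hypothesis (B): `B` is nonnegative, bounded, and locally Hölder continuous on
`Ω̄ × [0,∞)` with some exponent `ϑ ∈ (0,1)`. -/
def HypB (a b : ℝ) (B : ℝ → ℝ → ℝ) : Prop :=
  (∀ x t : ℝ, 0 ≤ B x t) ∧ (∃ M : ℝ, ∀ x t : ℝ, B x t ≤ M) ∧
  ∃ ϑ : ℝ, ϑ ∈ Set.Ioo (0:ℝ) 1 ∧
    ∀ K : Set (ℝ × ℝ), IsCompact K → K ⊆ (Set.Icc a b) ×ˢ (Set.Ici (0:ℝ)) →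
      ∃ C : ℝ, ∀ p ∈ K, ∀ q ∈ K, |B p.1 p.2 - B q.1 q.2| ≤ C * dist p q ^ ϑ

/-- Hypothesis (init): `u0 ∈ C⁰(Ω̄)` nonnegative, `v0 ∈ W^{1,∞}(Ω)` (i.e. Lipschitz)
positive on `Ω̄`. -/
def HypInit (a b : ℝ) (u0 v0 : ℝ → ℝ) : Prop :=
  ContinuousOn u0 (Set.Icc a b) ∧ (∀ x ∈ Set.Icc a b, 0 ≤ u0 x) ∧
  (∃ L : ℝ≥0, LipschitzOnWith L v0 (Set.Icc a b)) ∧ (∀ x ∈ Set.Icc a b, 0 < v0 x)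

/-- Hypothesis (H1): `∫_0^∞ ∫_Ω B1 < ∞`. -/
def HypH1 (a b : ℝ) (B1 : ℝ → ℝ → ℝ) : Prop :=
  MeasureTheory.IntegrableOn (fun p : ℝ × ℝ => B1 p.1 p.2)
    ((Set.Ioo a b) ×ˢ (Set.Ioi (0:ℝ)))

/-- Hypothesis (H1'): `∫_t^{t+1} ∫_Ω B1 → 0` as `t → ∞`. -/
def HypH1' (a b : ℝ) (B1 : ℝ → ℝ → ℝ) : Prop :=
  Filter.Tendsto (fun t : ℝ => ∫ s in t..(t+1), ∫ x in Set.Ioo a b, B1 x s)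
    Filter.atTop (nhds 0)

/-- Hypothesis (H2): `inf_{t>0} ∫_Ω B2(·,t) > 0`. -/
def HypH2 (a b : ℝ) (B2 : ℝ → ℝ → ℝ) : Prop :=
  ∃ c : ℝ, 0 < c ∧ ∀ t : ℝ, 0 < t → c ≤ ∫ x in Set.Ioo a b, B2 x t

/-- Hypothesis (H3): `B2(·,t)` stabilizes to `B2inf ∈ L²(Ω)` in the averaged `L²` sense. -/
def HypH3 (a b : ℝ) (B2 : ℝ → ℝ → ℝ) (B2inf : ℝ → ℝ) : Prop :=
  MeasureTheory.MemLp B2inf 2 (MeasureTheory.volume.restrict (Set.Ioo a b)) ∧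
  Filter.Tendsto
    (fun t : ℝ => ∫ s in t..(t+1), ∫ x in Set.Ioo a b, (B2 x s - B2inf x)^2)
    Filter.atTop (nhds 0)

/-- A classical solution of the urban crime system
`u_t = u_xx − χ (u/v · v_x)_x − uv + B1`, `v_t = v_xx + uv − v + B2` on
`Ω̄ × [0, Tmax)`, `Ω = (a,b)`, with homogeneous Neumann boundary conditions and
initial data `(u0, v0)`; `u, v` are positive on `Ω̄ × (0, Tmax)`, belong to
`C⁰(Ω̄ × [0,Tmax)) ∩ C^{2,1}(Ω̄ × (0,Tmax))` and `v(·,t)` lies in `W^{1,r}(Ω)`,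
continuously in `t`, for every `r > 1`. -/
structure CrimeSol (a b χ : ℝ) (B1 B2 : ℝ → ℝ → ℝ) (u0 v0 : ℝ → ℝ)
    (u v : ℝ → ℝ → ℝ) (Tmax : ℝ≥0∞) : Prop where
  u_cont : ContinuousOn (fun p : ℝ × ℝ => u p.1 p.2) ((Set.Icc a b) ×ˢ It Tmax)
  v_cont : ContinuousOn (fun p : ℝ × ℝ => v p.1 p.2) ((Set.Icc a b) ×ˢ It Tmax)
  u_init : ∀ x ∈ Set.Icc a b, u x 0 = u0 x
  v_init : ∀ x ∈ Set.Icc a b, v x 0 = v0 x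
  u_pos : ∀ x ∈ Set.Icc a b, ∀ t ∈ It' Tmax, 0 < u x t
  v_pos : ∀ x ∈ Set.Icc a b, ∀ t ∈ It' Tmax, 0 < v x t
  u_reg : ∀ x ∈ Set.Icc a b, ∀ t ∈ It' Tmax,
    DifferentiableAt ℝ (fun y => u y t) x ∧
    DifferentiableAt ℝ (fun y => pdx u y t) x ∧
    DifferentiableAt ℝ (fun s => u x s) t
  v_reg : ∀ x ∈ Set.Icc a b, ∀ t ∈ It' Tmax,
    DifferentiableAt ℝ (fun y => v y t) x ∧
    DifferentiableAt ℝ (fun y => pdx v y t) x ∧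
    DifferentiableAt ℝ (fun s => v x s) t
  u_cont21 : ContinuousOn
    (fun p : ℝ × ℝ => (pdx u p.1 p.2, pdx (pdx u) p.1 p.2, pdt u p.1 p.2))
    ((Set.Icc a b) ×ˢ It' Tmax)
  v_cont21 : ContinuousOn
    (fun p : ℝ × ℝ => (pdx v p.1 p.2, pdx (pdx v) p.1 p.2, pdt v p.1 p.2))
    ((Set.Icc a b) ×ˢ It' Tmax)
  v_W1r : ∀ r : ℝ, 1 < r →
    (∀ t ∈ It Tmax,
      MeasureTheory.IntegrableOn (fun x => |pdx v x t| ^ r) (Set.Ioo a b)) ∧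
    ContinuousOn (fun t => ∫ x in Set.Ioo a b, |pdx v x t| ^ r) (It Tmax)
  u_eq : ∀ x ∈ Set.Ioo a b, ∀ t ∈ It' Tmax,
    pdt u x t = pdx (pdx u) x t
      - χ * pdx (fun y s => u y s / v y s * pdx v y s) x t
      - u x t * v x t + B1 x t
  v_eq : ∀ x ∈ Set.Ioo a b, ∀ t ∈ It' Tmax,
    pdt v x t = pdx (pdx v) x t + u x t * v x t - v x t + B2 x t
  u_bc : ∀ t ∈ It' Tmax, pdx u a t = 0 ∧ pdx u b t = 0
  v_bc : ∀ t ∈ It' Tmax, pdx v a t = 0 ∧ pdx v b t = 0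

/-- A classical solution of the stationary Neumann problem
`−w'' + w = B` in `Ω = (a,b)`, `w' = 0` on `∂Ω`. -/
def IsStationarySol (a b : ℝ) (B : ℝ → ℝ) (w : ℝ → ℝ) : Prop :=
  ContinuousOn w (Set.Icc a b) ∧
  (∀ x ∈ Set.Icc a b, DifferentiableAt ℝ w x ∧ DifferentiableAt ℝ (deriv w) x) ∧
  (∀ x ∈ Set.Ioo a b, -(deriv (deriv w) x) + w x = B x) ∧
  deriv w a = 0 ∧ deriv w b = 0

/-- The branches `q^±(p) = (1−p)/2 · (1 ∓/± √(1 − pχ²))`. -/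
def qminus (χ p : ℝ) : ℝ := (1 - p) / 2 * (1 - Real.sqrt (1 - p * χ^2))

def qplus (χ p : ℝ) : ℝ := (1 - p) / 2 * (1 + Real.sqrt (1 - p * χ^2))

/-- The auxiliary functions `φ₁, φ₂, φ₃` and the constant `p₀`. -/
def phi1 (p : ℝ) : ℝ := (p + 1) / (1 - p)

def phi2 (χ p : ℝ) : ℝ := (1 - p) / (2 * p) * (1 + Real.sqrt (1 - p * χ^2))

def phi3 (χ p : ℝ) : ℝ := (1 - p) / (2 * p) * (1 - Real.sqrt (1 - p * χ^2))

def p0 : ℝ := (2 * Real.sqrt 3 - 3) / 3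

/-! ### Elementary helper lemmas -/

namespace CrimeAux

lemma ii {a b : ℝ} (hab : a < b) {f : ℝ → ℝ} (hf : ContinuousOn f (Icc a b)) :
    IntervalIntegrable f volume a b :=
  ContinuousOn.intervalIntegrable_of_Icc hab.le hf

lemma meas {a b : ℝ} (hab : a < b) {f : ℝ → ℝ} (hf : ContinuousOn f (Icc a b)) :
    AEStronglyMeasurable f (volume.restrict (uIoc a b)) :=
  (hf.mono (by rw [uIoc_of_le hab.le]; exact Ioc_subset_Icc_self)).aestronglyMeasurable
    measurableSet_uIoc

lemma int_mono {a b : ℝ} (hab : a < b) {f g : ℝ → ℝ} (hf : ContinuousOn f (Icc a b))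
    (hg : ContinuousOn g (Icc a b)) (h : ∀ x ∈ Icc a b, f x ≤ g x) :
    ∫ x in a..b, f x ≤ ∫ x in a..b, g x :=
  intervalIntegral.integral_mono_on hab.le (ii hab hf) (ii hab hg) h

lemma int_congr {a b : ℝ} (hab : a < b) {f g : ℝ → ℝ} (h : ∀ x ∈ Icc a b, f x = g x) :
    ∫ x in a..b, f x = ∫ x in a..b, g x := by
  apply intervalIntegral.integral_congr
  rw [uIcc_of_le hab.le]
  exact h

lemma int_nonneg {a b : ℝ} (hab : a < b) {f : ℝ → ℝ} (h : ∀ x ∈ Icc a b, 0 ≤ f x) :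
    0 ≤ ∫ x in a..b, f x :=
  intervalIntegral.integral_nonneg hab.le h

lemma int_le_const {a b : ℝ} (hab : a < b) {f : ℝ → ℝ} (hf : ContinuousOn f (Icc a b)) {K : ℝ}
    (h : ∀ x ∈ Icc a b, f x ≤ K) : ∫ x in a..b, f x ≤ (b - a) * K := by
  have := int_mono hab hf (continuousOn_const (c := K)) h
  simpa using this

lemma int_ge_const {a b : ℝ} (hab : a < b) {f : ℝ → ℝ} (hf : ContinuousOn f (Icc a b)) {K : ℝ}
    (h : ∀ x ∈ Icc a b, K ≤ f x) : (b - a) * K ≤ ∫ x in a..b, f x := by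
  have := int_mono hab (continuousOn_const (c := K)) hf h
  simpa using this

/-- linear combination of two integrals -/
lemma int_lin {a b : ℝ} (hab : a < b) {f g : ℝ → ℝ} (hf : ContinuousOn f (Icc a b))
    (hg : ContinuousOn g (Icc a b)) (c d : ℝ) :
    ∫ x in a..b, (c * f x + d * g x) = c * (∫ x in a..b, f x) + d * ∫ x in a..b, g x := by
  rw [intervalIntegral.integral_add ((ii hab hf).const_mul c) ((ii hab hg).const_mul d),
    intervalIntegral.integral_const_mul, intervalIntegral.integral_const_mul]

lemma exists_le_mean {a b : ℝ} (hab : a < b) {f : ℝ → ℝ} (hf : ContinuousOn f (Icc a b)) :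
    ∃ y ∈ Icc a b, (b - a) * f y ≤ ∫ x in a..b, f x := by
  obtain ⟨y, hy, hmin⟩ := isCompact_Icc.exists_isMinOn (nonempty_Icc.2 hab.le) hf
  exact ⟨y, hy, int_ge_const hab hf fun x hx => hmin hx⟩

lemma osc_le {a b : ℝ} (hab : a < b) {f f' : ℝ → ℝ}
    (hd : ∀ x ∈ Icc a b, HasDerivAt f (f' x) x) (hf' : ContinuousOn f' (Icc a b))
    {x y : ℝ} (hx : x ∈ Icc a b) (hy : y ∈ Icc a b) :
    f x - f y ≤ ∫ z in a..b, |f' z| := by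
  have hsub : uIcc y x ⊆ Icc a b := uIcc_subset_Icc hy hx
  have h1 : ∫ z in y..x, f' z = f x - f y :=
    intervalIntegral.integral_eq_sub_of_hasDerivAt (fun z hz => hd z (hsub hz))
      ((hf'.mono hsub).intervalIntegrable)
  rw [← h1]
  calc ∫ z in y..x, f' z ≤ |∫ z in y..x, f' z| := le_abs_self _
    _ ≤ abs (∫ z in y..x, abs (f' z)) := by
        simpa [Real.norm_eq_abs] using
          (intervalIntegral.norm_integral_le_abs_integral_norm (f := f') (a := y) (b := x)
            (μ := volume))
    _ ≤ abs (∫ z in a..b, abs (f' z)) := by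
        apply intervalIntegral.abs_integral_mono_interval
        · rw [uIoc_of_le hab.le]
          intro z hz
          rw [mem_uIoc] at hz
          rcases hz with h | h
          · exact ⟨lt_of_le_of_lt hy.1 h.1, h.2.trans hx.2⟩
          · exact ⟨lt_of_le_of_lt hx.1 h.1, h.2.trans hy.2⟩
        · exact Filter.Eventually.of_forall fun z => abs_nonneg _
        · exact ii hab hf'.abs
    _ = ∫ z in a..b, |f' z| := abs_of_nonneg (int_nonneg hab fun z _ => abs_nonneg _)

lemma cs {a b : ℝ} (hab : a < b) {f : ℝ → ℝ} (hf : ContinuousOn f (Icc a b)) :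
    (∫ x in a..b, |f x|) ^ 2 ≤ (b - a) * ∫ x in a..b, (f x) ^ 2 := by
  set m := ∫ x in a..b, |f x| with hm
  have hL : 0 < b - a := sub_pos.2 hab
  have h0 : 0 ≤ ∫ x in a..b, ((b - a) * |f x| - m) ^ 2 := int_nonneg hab fun x _ => sq_nonneg _
  have h1 : ∫ x in a..b, ((b - a) * |f x| - m) ^ 2
      = ∫ x in a..b, (1 * ((b-a)^2 * (f x)^2 + (-(2 * (b-a) * m)) * |f x|) + 1 * m ^ 2) := by
    apply int_congr hab
    intro x _
    have := sq_abs (f x)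
    linear_combination (b-a)^2 * this
  rw [h1, int_lin hab (by fun_prop) (by fun_prop), int_lin hab (by fun_prop) (by fun_prop)] at h0
  simp only [intervalIntegral.integral_const, smul_eq_mul, ← hm] at h0
  have h2 : 0 ≤ (b - a) * ((b-a) * (∫ x in a..b, (f x) ^ 2) - m^2) := by nlinarith
  have := nonneg_of_mul_nonneg_right h2 hL
  linarith

/-- integration by parts with vanishing boundary terms -/
lemma ibp {a b : ℝ} (hab : a < b) {f f' g g' : ℝ → ℝ}
    (hf : ∀ x ∈ Icc a b, HasDerivAt f (f' x) x) (hf' : ContinuousOn f' (Icc a b))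
    (hg : ∀ x ∈ Icc a b, HasDerivAt g (g' x) x) (hg' : ContinuousOn g' (Icc a b))
    (ha : f a = 0) (hb : f b = 0) :
    ∫ x in a..b, f' x * g x = - ∫ x in a..b, f x * g' x := by
  have h := intervalIntegral.integral_mul_deriv_eq_deriv_mul (a := a) (b := b) (u := f) (v := g)
    (u' := f') (v' := g') (by rw [uIcc_of_le hab.le]; exact hf)
    (by rw [uIcc_of_le hab.le]; exact hg) (ii hab hf') (ii hab hg')
  rw [h, ha, hb]
  ring

/-- barrier lemma -/
lemma barrier {y y' : ℝ → ℝ} {s K : ℝ} (hd : ∀ t, s ≤ t → HasDerivAt y (y' t) t)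
    (hK : y s ≤ K) (h : ∀ t, s ≤ t → y t = K → y' t < 0) : ∀ t, s ≤ t → y t ≤ K := by
  intro t ht
  refine image_le_of_deriv_right_lt_deriv_boundary (f := y) (f' := y') (a := s) (b := t)
    (B := fun _ => K) (B' := fun _ => 0)
    (fun x hx => (hd x hx.1).continuousAt.continuousWithinAt)
    (fun x hx => (hd x hx.1).hasDerivWithinAt) hK (fun x => hasDerivAt_const x K)
    (fun x hx hxe => h x hx.1 hxe) (right_mem_Icc.2 ht)

/-- a function with nonpositive derivative decreases -/
lemma anti {y y' : ℝ → ℝ} {s t : ℝ} (hst : s ≤ t) (hd : ∀ r ∈ Icc s t, HasDerivAt y (y' r) r)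
    (h : ∀ r ∈ Icc s t, y' r ≤ 0) : y t ≤ y s := by
  have : AntitoneOn y (Icc s t) := by
    apply antitoneOn_of_deriv_nonpos (convex_Icc s t)
    · exact fun x hx => (hd x hx).continuousAt.continuousWithinAt
    · intro x hx
      exact (hd x (interior_subset hx)).differentiableAt.differentiableWithinAt
    · intro x hx
      rw [(hd x (interior_subset hx)).deriv]
      exact h x (interior_subset hx)
  exact this (left_mem_Icc.2 hst) (right_mem_Icc.2 hst) hst

lemma slice {a b : ℝ} {G : ℝ → ℝ → ℝ}
    (hG : ContinuousOn (fun p : ℝ × ℝ => G p.1 p.2) (Icc a b ×ˢ Ioi 0)) {t : ℝ} (ht : 0 < t) :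
    ContinuousOn (fun x => G x t) (Icc a b) :=
  hG.comp (f := fun x : ℝ => (x, t)) (by fun_prop) (fun x hx => ⟨hx, ht⟩)

lemma slice_t {a b : ℝ} {G : ℝ → ℝ → ℝ}
    (hG : ContinuousOn (fun p : ℝ × ℝ => G p.1 p.2) (Icc a b ×ˢ Ioi 0)) {x t : ℝ}
    (hx : x ∈ Icc a b) (ht : 0 < t) : ContinuousAt (fun s => G x s) t := by
  have : ContinuousOn (fun s => G x s) (Ioi 0) :=
    hG.comp (f := fun s : ℝ => (x, s)) (by fun_prop) (fun s hs => ⟨hx, hs⟩)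
  exact this.continuousAt (Ioi_mem_nhds ht)

lemma loc_bound {a b : ℝ} {G : ℝ → ℝ → ℝ}
    (hG : ContinuousOn (fun p : ℝ × ℝ => G p.1 p.2) (Icc a b ×ˢ Ioi 0)) {t : ℝ} (ht : 0 < t) :
    ∃ K, 0 ≤ K ∧ ∀ s ∈ Icc (t/2) (2*t), ∀ x ∈ Icc a b, |G x s| ≤ K := by
  have hc : IsCompact (Icc a b ×ˢ Icc (t/2) (2*t)) := isCompact_Icc.prod isCompact_Icc
  obtain ⟨K, hK⟩ := hc.exists_bound_of_continuousOn (hG.mono (prod_mono le_rfl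
    (fun s hs => lt_of_lt_of_le (by positivity : (0:ℝ) < t/2) hs.1)))
  refine ⟨max K 0, le_max_right _ _, fun s hs x hx => ?_⟩
  exact (hK (x, s) ⟨hx, hs⟩).trans (le_max_left _ _)

lemma nhds_win {t : ℝ} (ht : 0 < t) : Icc (t/2) (2*t) ∈ 𝓝 t :=
  Icc_mem_nhds (by linarith) (by linarith)

/-- differentiation under the integral sign -/
lemma deriv_int {a b : ℝ} (hab : a < b) {F G : ℝ → ℝ → ℝ}
    (hF : ContinuousOn (fun p : ℝ × ℝ => F p.1 p.2) (Icc a b ×ˢ Ioi 0))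
    (hG : ContinuousOn (fun p : ℝ × ℝ => G p.1 p.2) (Icc a b ×ˢ Ioi 0))
    (hd : ∀ x ∈ Icc a b, ∀ t, 0 < t → HasDerivAt (fun s => F x s) (G x t) t) {t : ℝ}
    (ht : 0 < t) :
    HasDerivAt (fun s => ∫ x in a..b, F x s) (∫ x in a..b, G x t) t := by
  obtain ⟨K, -, hK⟩ := loc_bound hG ht
  have hsub : ∀ x, x ∈ uIoc a b → x ∈ Icc a b := by
    intro x hx
    rw [uIoc_of_le hab.le] at hx
    exact ⟨hx.1.le, hx.2⟩
  have hpos : ∀ s ∈ Icc (t/2) (2*t), 0 < s := fun s hs =>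
    lt_of_lt_of_le (by positivity : (0:ℝ) < t/2) hs.1
  refine (intervalIntegral.hasDerivAt_integral_of_dominated_loc_of_deriv_le
    (F := fun s x => F x s) (F' := fun s x => G x s) (bound := fun _ => K)
    (nhds_win ht) ?_ (ii hab (slice hF ht)) ?_ ?_ (by simp) ?_).2
  · filter_upwards [Ioi_mem_nhds ht] with s hs
    exact meas hab (slice hF hs)
  · exact meas hab (slice hG ht)
  · exact Eventually.of_forall fun x hx s hs => hK s hs x (hsub x hx)
  · exact Eventually.of_forall fun x hx s hs => hd x (hsub x hx) s (hpos s hs)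

lemma cont_int {a b : ℝ} (hab : a < b) {F : ℝ → ℝ → ℝ}
    (hF : ContinuousOn (fun p : ℝ × ℝ => F p.1 p.2) (Icc a b ×ˢ Ioi 0)) {t : ℝ}
    (ht : 0 < t) : ContinuousAt (fun s => ∫ x in a..b, F x s) t := by
  obtain ⟨K, -, hK⟩ := loc_bound hF ht
  have hsub : ∀ x, x ∈ uIoc a b → x ∈ Icc a b := by
    intro x hx
    rw [uIoc_of_le hab.le] at hx
    exact ⟨hx.1.le, hx.2⟩
  refine intervalIntegral.continuousAt_of_dominated_interval (F := fun s x => F x s)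
    (bound := fun _ => K) ?_ ?_ (by simp) ?_
  · filter_upwards [Ioi_mem_nhds ht] with s hs
    exact meas hab (slice hF hs)
  · filter_upwards [nhds_win ht] with s hs
    exact Eventually.of_forall fun x hx => hK s hs x (hsub x hx)
  · exact Eventually.of_forall fun x hx => slice_t hF (hsub x hx) ht

/-- A `C^{2,1}` function on `[a,b] × (0,∞)` with Neumann boundary conditions. -/
structure Reg (a b : ℝ) (w wx wxx wt : ℝ → ℝ → ℝ) : Prop where
  c : ContinuousOn (fun p : ℝ × ℝ => w p.1 p.2) (Icc a b ×ˢ Ioi 0)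
  cx : ContinuousOn (fun p : ℝ × ℝ => wx p.1 p.2) (Icc a b ×ˢ Ioi 0)
  cxx : ContinuousOn (fun p : ℝ × ℝ => wxx p.1 p.2) (Icc a b ×ˢ Ioi 0)
  ct : ContinuousOn (fun p : ℝ × ℝ => wt p.1 p.2) (Icc a b ×ˢ Ioi 0)
  dx : ∀ x ∈ Icc a b, ∀ t, 0 < t → HasDerivAt (fun y => w y t) (wx x t) x
  dxx : ∀ x ∈ Icc a b, ∀ t, 0 < t → HasDerivAt (fun y => wx y t) (wxx x t) x
  dt : ∀ x ∈ Icc a b, ∀ t, 0 < t → HasDerivAt (fun s => w x s) (wt x t) t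
  ba : ∀ t, 0 < t → wx a t = 0
  bb : ∀ t, 0 < t → wx b t = 0

lemma Reg.sq_diff {a b : ℝ} (hab : a < b) {w wx wxx wt : ℝ → ℝ → ℝ} (h : Reg a b w wx wxx wt)
    {t s : ℝ} (ht : 0 < t) (hs : 0 < s) :
    (∫ x in a..b, (wx x s)^2) - ∫ x in a..b, (wx x t)^2
      = - ∫ x in a..b, (w x s - w x t) * (wxx x s + wxx x t) := by
  have c1 := slice h.cx ht
  have c2 := slice h.cx hs
  have c3 := slice h.cxx ht
  have c4 := slice h.cxx hs
  have e := ibp hab (f := fun x => wx x s + wx x t) (f' := fun x => wxx x s + wxx x t)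
    (g := fun x => w x s - w x t) (g' := fun x => wx x s - wx x t)
    (fun x hx => (h.dxx x hx s hs).add (h.dxx x hx t ht)) (c4.add c3)
    (fun x hx => (h.dx x hx s hs).sub (h.dx x hx t ht)) (c2.sub c1)
    (by simp [h.ba s hs, h.ba t ht]) (by simp [h.bb s hs, h.bb t ht])
  have e1 : (∫ x in a..b, (w x s - w x t) * (wxx x s + wxx x t))
      = ∫ x in a..b, (wxx x s + wxx x t) * (w x s - w x t) :=
    int_congr hab fun x _ => by ring
  rw [e1, e, neg_neg, ← intervalIntegral.integral_sub (ii hab (by fun_prop)) (ii hab (by fun_prop))]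
  exact int_congr hab fun x _ => by ring

lemma Reg.deriv_sq {a b : ℝ} (hab : a < b) {w wx wxx wt : ℝ → ℝ → ℝ} (h : Reg a b w wx wxx wt)
    {t : ℝ} (ht : 0 < t) :
    HasDerivAt (fun s => ∫ x in a..b, (wx x s)^2) (∫ x in a..b, -(2 * (wt x t * wxx x t))) t := by
  have hsub : ∀ x, x ∈ uIoc a b → x ∈ Icc a b := by
    intro x hx
    rw [uIoc_of_le hab.le] at hx
    exact ⟨hx.1.le, hx.2⟩
  have hpos : ∀ s ∈ Icc (t/2) (2*t), 0 < s := fun s hs =>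
    lt_of_lt_of_le (by positivity : (0:ℝ) < t/2) hs.1
  obtain ⟨K, hK0, hK⟩ := loc_bound h.ct ht
  obtain ⟨N, hN0, hN⟩ := loc_bound h.cxx ht
  rw [hasDerivAt_iff_tendsto_slope]
  have key : Tendsto (fun s => ∫ x in a..b,
      -((s - t)⁻¹ * (w x s - w x t) * (wxx x s + wxx x t))) (𝓝[≠] t)
      (𝓝 (∫ x in a..b, -(2 * (wt x t * wxx x t)))) := by
    refine intervalIntegral.tendsto_integral_filter_of_dominated_convergence
      (bound := fun _ => K * (N + N)) ?_ ?_ (by simp) ?_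
    · filter_upwards [mem_nhdsWithin_of_mem_nhds (Ioi_mem_nhds ht)] with s hs
      have c1 := slice h.c ht
      have c2 := slice h.c hs
      have c3 := slice h.cxx ht
      have c4 := slice h.cxx hs
      exact meas hab (by fun_prop)
    · filter_upwards [mem_nhdsWithin_of_mem_nhds (nhds_win ht), self_mem_nhdsWithin] with s hs hst
      refine Eventually.of_forall fun x hx => ?_
      have hx' := hsub x hx
      have tm : t ∈ Icc (t/2) (2*t) := mem_of_mem_nhds (nhds_win ht)
      have hl : ‖w x s - w x t‖ ≤ K * ‖s - t‖ :=
        (convex_Icc (t/2) (2*t)).norm_image_sub_le_of_norm_hasDerivWithin_le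
          (f := fun s => w x s) (f' := fun s => wt x s)
          (fun r hr => (h.dt x hx' r (hpos r hr)).hasDerivWithinAt)
          (fun r hr => hK r hr x hx') tm hs
      have hst' : 0 < ‖s - t‖ := norm_pos_iff.2 (sub_ne_zero.2 hst)
      rw [norm_neg, norm_mul, norm_mul, norm_inv]
      have e1 : ‖s - t‖⁻¹ * ‖w x s - w x t‖ ≤ K := by
        rw [inv_mul_le_iff₀ hst']; linarith
      have e2 : ‖wxx x s + wxx x t‖ ≤ N + N :=
        (norm_add_le _ _).trans (add_le_add (hN s hs x hx') (hN t tm x hx'))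
      exact mul_le_mul e1 e2 (norm_nonneg _) hK0
    · refine Eventually.of_forall fun x hx => ?_
      have hx' := hsub x hx
      have d := hasDerivAt_iff_tendsto_slope.1 (h.dt x hx' t ht)
      have c : Tendsto (fun s => wxx x s + wxx x t) (𝓝[≠] t) (𝓝 (wxx x t + wxx x t)) :=
        ((slice_t h.cxx hx' ht).tendsto.add_const _).mono_left nhdsWithin_le_nhds
      have := (d.mul c).neg
      convert this using 2
      · simp only [slope, vsub_eq_sub, smul_eq_mul]
      · ring
  refine key.congr' ?_
  filter_upwards [mem_nhdsWithin_of_mem_nhds (Ioi_mem_nhds ht)] with s hs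
  simp only [slope, vsub_eq_sub, smul_eq_mul]
  rw [h.sq_diff hab ht hs, mul_neg, ← intervalIntegral.integral_const_mul,
    ← intervalIntegral.integral_neg]
  exact int_congr hab fun x _ => by ring

lemma second_deriv_min {a b : ℝ} (hab : a < b) {f f' : ℝ → ℝ} {c : ℝ} {x : ℝ} (hx : x ∈ Icc a b)
    (hd : ∀ y ∈ Icc a b, HasDerivAt f (f' y) y) (hdd : HasDerivAt f' c x)
    (h0a : f' a = 0) (h0b : f' b = 0) (hmin : ∀ y ∈ Icc a b, f x ≤ f y) : 0 ≤ c := by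
  by_contra hc
  push Not at hc
  have hfx : f' x = 0 := by
    rcases eq_or_lt_of_le hx.1 with h | h
    · rw [← h, h0a]
    rcases eq_or_lt_of_le hx.2 with h' | h'
    · rw [h', h0b]
    · have : IsLocalMin f x := by
        filter_upwards [Icc_mem_nhds h h'] with y hy using hmin y hy
      exact this.hasDerivAt_eq_zero (hd x hx)
  have hs := hasDerivAt_iff_tendsto_slope.1 hdd
  have hev : ∀ᶠ y in 𝓝[≠] x, slope f' x y < 0 := hs.eventually (gt_mem_nhds hc)
  rw [eventually_nhdsWithin_iff, Metric.eventually_nhds_iff] at hev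
  obtain ⟨ε, hε, hev⟩ := hev
  rcases lt_or_ge x b with h | h
  · set y := min b (x + ε/2) with hy
    have hxy : x < y := lt_min h (by linarith)
    have hyb : y ≤ b := min_le_left _ _
    obtain ⟨z, hz, hze⟩ := exists_hasDerivAt_eq_slope f f' hxy
      (fun r hr => (hd r ⟨hx.1.trans hr.1, hr.2.trans hyb⟩).continuousAt.continuousWithinAt)
      (fun r hr => hd r ⟨hx.1.trans hr.1.le, hr.2.le.trans hyb⟩)
    have h1 : 0 ≤ f' z := by
      rw [hze]
      exact div_nonneg (sub_nonneg.2 (hmin y ⟨hx.1.trans hxy.le, hyb⟩)) (by linarith)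
    have hzε : z ≤ x + ε/2 := hz.2.le.trans (min_le_right _ _)
    have h2 := hev (y := z) (by rw [Real.dist_eq, abs_of_pos (by linarith [hz.1])]; linarith)
      (ne_of_gt hz.1)
    rw [slope_def_field, hfx, sub_zero] at h2
    have := div_nonneg h1 (by linarith [hz.1] : 0 ≤ z - x)
    linarith
  · have hxb : x = b := le_antisymm hx.2 h
    have hax : a < x := hxb ▸ hab
    set y := max a (x - ε/2) with hy
    have hxy : y < x := max_lt hax (by linarith)
    have hya : a ≤ y := le_max_left _ _
    obtain ⟨z, hz, hze⟩ := exists_hasDerivAt_eq_slope f f' hxy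
      (fun r hr => (hd r ⟨hya.trans hr.1, hr.2.trans hx.2⟩).continuousAt.continuousWithinAt)
      (fun r hr => hd r ⟨hya.trans hr.1.le, hr.2.le.trans hx.2⟩)
    have h1 : f' z ≤ 0 := by
      rw [hze]
      exact div_nonpos_of_nonpos_of_nonneg (sub_nonpos.2 (hmin y ⟨hya, hxy.le.trans hx.2⟩))
        (by linarith)
    have hzε : x - ε/2 ≤ z := (le_max_right _ _).trans hz.1.le
    have h2 := hev (y := z) (by rw [Real.dist_eq, abs_of_neg (by linarith [hz.2])]; linarith)
      (ne_of_lt hz.2)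
    rw [slope_def_field, hfx, sub_zero] at h2
    have := div_nonneg_of_nonpos h1 (by linarith [hz.2] : z - x ≤ 0)
    linarith

/-- minimum principle for `w_t ≥ w_xx - w` -/
lemma Reg.min_principle {a b : ℝ} (hab : a < b) {w wx wxx wt : ℝ → ℝ → ℝ}
    (h : Reg a b w wx wxx wt)
    (hle : ∀ x ∈ Icc a b, ∀ t, 0 < t → wxx x t - w x t ≤ wt x t)
    {s T m : ℝ} (hs : 0 < s) (hsT : s ≤ T) (hm : ∀ x ∈ Icc a b, m ≤ w x s) :
    ∀ x ∈ Icc a b, m * Real.exp (-(T - s)) ≤ w x T := by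
  have main : ∀ ε > 0, ∀ x ∈ Icc a b, m ≤ Real.exp (T - s) * w x T + ε * (T - s) := by
    intro ε hε x hx
    have hsub : Icc a b ×ˢ Icc s T ⊆ Icc a b ×ˢ Ioi (0:ℝ) :=
      prod_mono le_rfl (fun r hr => lt_of_lt_of_le hs hr.1)
    have hc : ContinuousOn (fun p : ℝ × ℝ => Real.exp (p.2 - s) * w p.1 p.2 + ε * (p.2 - s))
        (Icc a b ×ˢ Icc s T) := by
      have := h.c.mono hsub
      fun_prop
    obtain ⟨⟨x1, t1⟩, ⟨hx1, ht1⟩, hmin⟩ := (isCompact_Icc.prod isCompact_Icc).exists_isMinOn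
      (s := Icc a b ×ˢ Icc s T) ⟨(x, s), hx, left_mem_Icc.2 hsT⟩ hc
    have hmin' : ∀ y ∈ Icc a b, ∀ r ∈ Icc s T,
        Real.exp (t1 - s) * w x1 t1 + ε * (t1 - s) ≤ Real.exp (r - s) * w y r + ε * (r - s) :=
      fun y hy r hr => hmin (a := (y, r)) ⟨hy, hr⟩
    simp only at hx1 ht1
    rcases eq_or_lt_of_le ht1.1 with he | hlt
    · have := hmin' x hx T (right_mem_Icc.2 hsT)
      rw [← he] at this
      simp only [sub_self, Real.exp_zero, one_mul, mul_zero, add_zero] at this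
      exact (hm x1 hx1).trans this
    · exfalso
      have ht0 : 0 < t1 := hs.trans hlt
      have h1 : 0 ≤ wxx x1 t1 := by
        refine second_deriv_min hab hx1 (fun y hy => h.dx y hy t1 ht0) (h.dxx x1 hx1 t1 ht0)
          (h.ba t1 ht0) (h.bb t1 ht0) (fun y hy => ?_)
        have := hmin' y hy t1 ht1
        have h2 : Real.exp (t1 - s) * w x1 t1 ≤ Real.exp (t1 - s) * w y t1 := by linarith
        exact le_of_mul_le_mul_left h2 (Real.exp_pos _)
      have hd : HasDerivAt (fun r => Real.exp (r - s) * w x1 r + ε * (r - s))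
          ((Real.exp (t1 - s) * 1) * w x1 t1 + Real.exp (t1 - s) * wt x1 t1 + ε * 1) t1 :=
        ((((hasDerivAt_id t1).sub_const s).exp.mul (h.dt x1 hx1 t1 ht0))).add
          (((hasDerivAt_id t1).sub_const s).const_mul ε)
      have h3 := hle x1 hx1 t1 ht0
      have hE := Real.exp_pos (t1 - s)
      have hpos : 0 < (Real.exp (t1 - s) * 1) * w x1 t1 + Real.exp (t1 - s) * wt x1 t1 + ε * 1 := by
        nlinarith
      have hsl := hasDerivAt_iff_tendsto_slope_left_right.1 hd |>.1
      have hev := hsl.eventually (lt_mem_nhds hpos)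
      have hmem : Ioo s t1 ∈ 𝓝[<] t1 := Ioo_mem_nhdsLT hlt
      obtain ⟨r, hr1, hr2⟩ := (hev.and hmem).exists
      rw [slope_def_field] at hr1
      have h4 := hmin' x1 hx1 r ⟨hr2.1.le, hr2.2.le.trans ht1.2⟩
      have h5 := div_nonpos_of_nonneg_of_nonpos (sub_nonneg.2 h4)
        (by linarith [hr2.2] : r - t1 ≤ 0)
      linarith
  intro x hx
  have h1 : m ≤ Real.exp (T - s) * w x T := by
    apply le_of_forall_pos_le_add
    intro η hη
    have := main (η / (T - s + 1)) (by have : 0 ≤ T - s := sub_nonneg.2 hsT; positivity) x hx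
    have h2 : η / (T - s + 1) * (T - s) ≤ η := by
      have : 0 ≤ T - s := sub_nonneg.2 hsT
      rw [div_mul_eq_mul_div, div_le_iff₀ (by positivity)]
      nlinarith
    linarith
  rw [Real.exp_neg, ← div_eq_mul_inv, div_le_iff₀ (Real.exp_pos _)]
  linarith


/-- The crime system in a convenient form. -/
structure Sys (a b χ M c : ℝ) (u ux uxx ut v vx vxx vt B1 B2 : ℝ → ℝ → ℝ) : Prop where
  hab : a < b
  hχ : 0 < χ
  hc : 0 < c
  ru : Reg a b u ux uxx ut
  rv : Reg a b v vx vxx vt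
  up : ∀ x ∈ Icc a b, ∀ t, 0 < t → 0 < u x t
  vp : ∀ x ∈ Icc a b, ∀ t, 0 < t → 0 < v x t
  b1c : ContinuousOn (fun p : ℝ × ℝ => B1 p.1 p.2) (Icc a b ×ˢ Ioi 0)
  b2c : ContinuousOn (fun p : ℝ × ℝ => B2 p.1 p.2) (Icc a b ×ˢ Ioi 0)
  b1n : ∀ x t, 0 ≤ B1 x t
  b2n : ∀ x t, 0 ≤ B2 x t
  b1m : ∀ x t, B1 x t ≤ M
  b2m : ∀ x t, B2 x t ≤ M
  b2l : ∀ t, 0 < t → c ≤ ∫ x in a..b, B2 x t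
  ueq : ∀ x ∈ Icc a b, ∀ t, 0 < t → ut x t = uxx x t
    - χ * (ux x t * (vx x t / v x t) + u x t * (vxx x t / v x t) - u x t * (vx x t / v x t) ^ 2)
    - u x t * v x t + B1 x t
  veq : ∀ x ∈ Icc a b, ∀ t, 0 < t → vt x t = vxx x t + u x t * v x t - v x t + B2 x t

section
variable {a b χ M c : ℝ} {u ux uxx ut v vx vxx vt B1 B2 : ℝ → ℝ → ℝ}

lemma int_abs_le (hab : a < b) {f : ℝ → ℝ} (hf : ContinuousOn f (Icc a b)) :
    ∫ x in a..b, |f x| ≤ ((b - a) + ∫ x in a..b, (f x) ^ 2) / 2 := by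
  have h1 := int_mono hab (f := fun x => |f x|) (g := fun x => (1/2) * 1 + (1/2) * (f x)^2)
    (by fun_prop) (by fun_prop) (fun x _ => by
      have := sq_abs (f x)
      nlinarith [sq_nonneg (|f x| - 1)])
  rw [int_lin hab (by fun_prop) (by fun_prop)] at h1
  simp only [intervalIntegral.integral_const, smul_eq_mul] at h1
  linarith

/-- the functional `∫ log (v/(1+v))` and its derivative -/
lemma Sys.phi_deriv (h : Sys a b χ M c u ux uxx ut v vx vxx vt B1 B2) {t : ℝ} (ht : 0 < t) :
    ∃ d, HasDerivAt (fun s => ∫ x in a..b, (Real.log (v x s) - Real.log (1 + v x s))) d t ∧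
      (∫ x in a..b, (vx x t / (v x t * (1 + v x t)))^2) - (b - a)
        + (∫ x in a..b, B2 x t * (1 / (v x t * (1 + v x t)))) ≤ d := by
  have hab := h.hab
  have c1 := h.rv.c
  have c2 := h.rv.ct
  have hv0 : ∀ p ∈ Icc a b ×ˢ Ioi (0:ℝ), v p.1 p.2 ≠ 0 := fun p hp =>
    (h.vp p.1 hp.1 p.2 hp.2).ne'
  have hv1 : ∀ p ∈ Icc a b ×ˢ Ioi (0:ℝ), 1 + v p.1 p.2 ≠ 0 := fun p hp => by
    have := h.vp p.1 hp.1 p.2 hp.2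
    positivity
  refine ⟨_, deriv_int hab (F := fun x s => Real.log (v x s) - Real.log (1 + v x s))
    (G := fun x s => vt x s / v x s - vt x s / (1 + v x s)) (by fun_prop (disch := assumption))
    (by fun_prop (disch := assumption)) (fun x hx s hs => ?_) ht, ?_⟩
  · have hp := h.vp x hx s hs
    exact ((h.rv.dt x hx s hs).log hp.ne').sub
      (((h.rv.dt x hx s hs).const_add 1).log (by positivity))
  have s1 := slice h.rv.c ht
  have s2 := slice h.rv.cx ht
  have s3 := slice h.rv.cxx ht
  have s4 := slice h.ru.c ht
  have s5 := slice h.b2c ht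
  have s6 := slice h.rv.ct ht
  have z0 : ∀ x ∈ Icc a b, v x t ≠ 0 := fun x hx => (h.vp x hx t ht).ne'
  have z1 : ∀ x ∈ Icc a b, 1 + v x t ≠ 0 := fun x hx => by
    have := h.vp x hx t ht
    positivity
  have z2 : ∀ x ∈ Icc a b, v x t * (1 + v x t) ≠ 0 := fun x hx => mul_ne_zero (z0 x hx) (z1 x hx)
  have z3 : ∀ x ∈ Icc a b, v x t ^ 2 ≠ 0 := fun x hx => pow_ne_zero 2 (z0 x hx)
  have z4 : ∀ x ∈ Icc a b, (1 + v x t) ^ 2 ≠ 0 := fun x hx => pow_ne_zero 2 (z1 x hx)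
  have e := ibp hab (f := fun x => vx x t) (f' := fun x => vxx x t)
    (g := fun x => (v x t)⁻¹ - (1 + v x t)⁻¹)
    (g' := fun x => -vx x t / (v x t)^2 - -vx x t / (1 + v x t)^2)
    (fun x hx => h.rv.dxx x hx t ht) s3
    (fun x hx => ((h.rv.dx x hx t ht).inv (z0 x hx)).sub
      (((h.rv.dx x hx t ht).const_add 1).inv (z1 x hx)))
    (by fun_prop (disch := assumption)) (h.rv.ba t ht) (h.rv.bb t ht)
  have i1 : ∫ x in a..b, (vt x t / v x t - vt x t / (1 + v x t))
      = ∫ x in a..b, (1 * (vxx x t * ((v x t)⁻¹ - (1 + v x t)⁻¹))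
        + 1 * ((u x t * v x t - v x t + B2 x t) * ((v x t)⁻¹ - (1 + v x t)⁻¹))) := by
    refine int_congr hab fun x hx => ?_
    rw [h.veq x hx t ht]
    ring
  rw [i1, int_lin hab (by fun_prop (disch := assumption)) (by fun_prop (disch := assumption)), e,
    ← intervalIntegral.integral_neg]
  have i2 := int_mono hab (f := fun x => (vx x t / (v x t * (1 + v x t)))^2)
    (g := fun x => -(vx x t * (-vx x t / (v x t)^2 - -vx x t / (1 + v x t)^2)))
    (by fun_prop (disch := assumption)) (by fun_prop (disch := assumption)) (fun x hx => by
      have hp := h.vp x hx t ht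
      have : -(vx x t * (-vx x t / (v x t)^2 - -vx x t / (1 + v x t)^2))
        - (vx x t / (v x t * (1 + v x t)))^2 = 2 * v x t * (vx x t / (v x t * (1 + v x t)))^2 := by
        field_simp
        ring
      have h2 : 0 ≤ 2 * v x t * (vx x t / (v x t * (1 + v x t)))^2 := by positivity
      linarith)
  have i3 := int_mono hab
    (f := fun x => 1 * (B2 x t * (1 / (v x t * (1 + v x t)))) + (-1) * 1)
    (g := fun x => (u x t * v x t - v x t + B2 x t) * ((v x t)⁻¹ - (1 + v x t)⁻¹))
    (by fun_prop (disch := assumption)) (by fun_prop (disch := assumption)) (fun x hx => by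
      have hp := h.vp x hx t ht
      have hu := h.up x hx t ht
      have e1 : (v x t)⁻¹ - (1 + v x t)⁻¹ = 1 / (v x t * (1 + v x t)) := by
        field_simp
        ring
      have e2 : (u x t * v x t - v x t + B2 x t) * ((v x t)⁻¹ - (1 + v x t)⁻¹)
        = B2 x t * (1 / (v x t * (1 + v x t))) + u x t / (1 + v x t) - 1 / (1 + v x t) := by
        rw [e1]
        field_simp
        ring
      have e3 : 1 / (1 + v x t) ≤ 1 := by
        rw [div_le_one (by positivity)]
        linarith
      have e4 : 0 ≤ u x t / (1 + v x t) := by positivity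
      rw [e2]
      linarith)
  rw [int_lin hab (by fun_prop (disch := assumption)) (by fun_prop)] at i3
  simp only [intervalIntegral.integral_const, smul_eq_mul] at i3
  linarith

lemma Sys.lower (h : Sys a b χ M c u ux uxx ut v vx vxx vt B1 B2) :
    ∃ δ, 0 < δ ∧ ∀ t, 2 ≤ t → ∀ x ∈ Icc a b, δ ≤ v x t := by
  have hab := h.hab
  have hL : 0 < b - a := sub_pos.2 hab
  have hc := h.hc
  set L := b - a with hLdef
  set y : ℝ → ℝ := fun s => ∫ x in a..b, (Real.log (v x s) - Real.log (1 + v x s)) with hy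
  choose! d hd1 hd2 using fun t (ht : 0 < t) => h.phi_deriv ht
  have osc : ∀ t, 0 < t → ∀ x ∈ Icc a b, ∀ z ∈ Icc a b,
      (Real.log (v x t) - Real.log (1 + v x t)) - (Real.log (v z t) - Real.log (1 + v z t)) ≤
      (L + ∫ x in a..b, (vx x t / (v x t * (1 + v x t)))^2) / 2 := by
    intro t ht x hx z hz
    have s1 := slice h.rv.c ht
    have s2 := slice h.rv.cx ht
    have z2 : ∀ x ∈ Icc a b, v x t * (1 + v x t) ≠ 0 := fun x hx => by
      have := h.vp x hx t ht
      positivity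
    refine (osc_le hab (f := fun x => Real.log (v x t) - Real.log (1 + v x t))
      (f' := fun x => vx x t / (v x t * (1 + v x t))) (fun x hx => ?_)
      (by fun_prop (disch := assumption)) hx hz).trans
      (int_abs_le hab (by fun_prop (disch := assumption)))
    have hp := h.vp x hx t ht
    have := ((h.rv.dx x hx t ht).log hp.ne').sub
      (((h.rv.dx x hx t ht).const_add 1).log (by positivity))
    have e : vx x t / (v x t * (1 + v x t)) = vx x t / v x t - vx x t / (1 + v x t) := by
      field_simp
      ring
    simp only [e]
    exact this
  have contφ : ∀ t, 0 < t →
      ContinuousOn (fun x => Real.log (v x t) - Real.log (1 + v x t)) (Icc a b) := by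
    intro t ht
    have s1 := slice h.rv.c ht
    have z0 : ∀ x ∈ Icc a b, v x t ≠ 0 := fun x hx => (h.vp x hx t ht).ne'
    have z1 : ∀ x ∈ Icc a b, 1 + v x t ≠ 0 := fun x hx => by
      have := h.vp x hx t ht
      positivity
    fun_prop (disch := assumption)
  set k := 1 + 4 * (L + 1) / c with hk
  have hk0 : 0 < 4 * (L + 1) / c := by positivity
  set N := max (L * (k + L + 1)) (- y 1) with hN
  have hN0 : 0 ≤ N := le_trans (by positivity) (le_max_left _ _)
  have hyN : ∀ t, 1 ≤ t → - y t ≤ N := by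
    refine barrier (y := fun t => - y t) (y' := fun t => - d t)
      (fun t ht => (hd1 t (by linarith)).neg) (le_max_right _ _) ?_
    intro t ht hyt
    have ht0 : 0 < t := by linarith
    have hdt := hd2 t ht0
    have hB : 0 ≤ ∫ x in a..b, B2 x t * (1 / (v x t * (1 + v x t))) := by
      refine int_nonneg hab fun x hx => ?_
      have hp := h.vp x hx t ht0
      have := h.b2n x t
      positivity
    by_cases hD : L + 1 ≤ ∫ x in a..b, (vx x t / (v x t * (1 + v x t)))^2
    · linarith
    push Not at hD
    obtain ⟨z, hz, hzm⟩ := exists_le_mean hab (contφ t ht0)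
    have hzm' : L * (Real.log (v z t) - Real.log (1 + v z t)) ≤ - (L * (k + L + 1)) := by
      have h1 : y t = ∫ x in a..b, (Real.log (v x t) - Real.log (1 + v x t)) := rfl
      have h2 := le_max_left (L * (k + L + 1)) (- y 1)
      rw [← hN] at h2
      linarith
    have hz2 : Real.log (v z t) - Real.log (1 + v z t) ≤ - (k + L + 1) := by
      by_contra hcon
      push Not at hcon
      nlinarith
    have hpt : ∀ x ∈ Icc a b, k / 4 ≤ 1 / (v x t * (1 + v x t)) := by
      intro x hx
      have hp := h.vp x hx t ht0
      have h1 := osc t ht0 x hx z hz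
      have h2 : Real.log (v x t) - Real.log (1 + v x t) ≤ - k := by linarith
      rw [← Real.log_div hp.ne' (by positivity), Real.log_le_iff_le_exp (by positivity),
        Real.exp_neg, div_le_iff₀ (by positivity)] at h2
      have h3 := Real.add_one_le_exp k
      have h4 : 0 < Real.exp k := Real.exp_pos k
      have h5 : v x t * Real.exp k ≤ 1 + v x t := by
        calc v x t * Real.exp k ≤ ((Real.exp k)⁻¹ * (1 + v x t)) * Real.exp k := by gcongr
          _ = 1 + v x t := by field_simp
      have h6 : v x t * (k + 1) ≤ 1 + v x t := le_trans (by gcongr) h5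
      have hk1 : 1 ≤ k := by linarith
      have h7 : v x t ≤ 1 := by nlinarith
      rw [le_div_iff₀ (by positivity)]
      have h8 : v x t * k ≤ 1 := by nlinarith
      nlinarith
    have s1 := slice h.rv.c ht0
    have s5 := slice h.b2c ht0
    have z2 : ∀ x ∈ Icc a b, v x t * (1 + v x t) ≠ 0 := fun x hx => by
      have := h.vp x hx t ht0
      positivity
    have hB' := int_mono hab (f := fun x => (k/4) * B2 x t)
      (g := fun x => B2 x t * (1 / (v x t * (1 + v x t)))) (by fun_prop)
      (by fun_prop (disch := assumption)) (fun x hx => by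
        have := hpt x hx
        have := h.b2n x t
        nlinarith)
    rw [intervalIntegral.integral_const_mul] at hB'
    have hcc := h.b2l t ht0
    have h9 : k / 4 * c ≤ k / 4 * ∫ x in a..b, B2 x t := by
      have : 0 ≤ k / 4 := by positivity
      gcongr
    have h10 : k / 4 * c = c / 4 + (L + 1) := by
      rw [hk]
      field_simp
    have hD0 : 0 ≤ ∫ x in a..b, (vx x t / (v x t * (1 + v x t)))^2 :=
      int_nonneg hab fun x _ => sq_nonneg _
    show - d t < 0
    linarith
  have hy0 : ∀ t, 0 < t → y t ≤ 0 := by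
    intro t ht
    have := int_le_const hab (contφ t ht) (K := 0) (fun x hx => by
      have hp := h.vp x hx t ht
      have := Real.log_le_log hp (by linarith : v x t ≤ 1 + v x t)
      linarith)
    simpa using this
  refine ⟨Real.exp (-(N / L + (2 * L + N) / 2)) * Real.exp (-1), by positivity, ?_⟩
  intro t ht x hx
  obtain ⟨ξ, hξ, hξe⟩ := exists_hasDerivAt_eq_slope y d (by linarith : t - 1 < t)
    (fun r hr => (hd1 r (by linarith [hr.1])).continuousAt.continuousWithinAt)
    (fun r hr => hd1 r (by linarith [hr.1]))
  have hξ0 : 0 < ξ := by linarith [hξ.1]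
  have hdξ : d ξ ≤ N := by
    rw [hξe, show t - (t - 1) = 1 by ring, div_one]
    have := hyN (t - 1) (by linarith)
    have := hy0 t (by linarith)
    linarith
  have hB : 0 ≤ ∫ x in a..b, B2 x ξ * (1 / (v x ξ * (1 + v x ξ))) := by
    refine int_nonneg hab fun x hx => ?_
    have hp := h.vp x hx ξ hξ0
    have := h.b2n x ξ
    positivity
  have hdd := hd2 ξ hξ0
  obtain ⟨z, hz, hzm⟩ := exists_le_mean hab (contφ ξ hξ0).neg
  have hzm' : - (N / L) ≤ Real.log (v z ξ) - Real.log (1 + v z ξ) := by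
    have h1 := hyN ξ (by linarith [hξ.1])
    have h2 : y ξ = ∫ x in a..b, (Real.log (v x ξ) - Real.log (1 + v x ξ)) := rfl
    simp only [Pi.neg_apply] at hzm
    rw [intervalIntegral.integral_neg] at hzm
    have h3 : -(Real.log (v z ξ) - Real.log (1 + v z ξ)) ≤ N / L := by
      rw [le_div_iff₀ hL]
      linarith
    linarith
  have hm : ∀ x ∈ Icc a b, Real.exp (-(N / L + (2 * L + N) / 2)) ≤ v x ξ := by
    intro x hx
    have hp := h.vp x hx ξ hξ0
    have h1 := osc ξ hξ0 z hz x hx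
    have h2 : 0 ≤ Real.log (1 + v x ξ) := Real.log_nonneg (by linarith)
    rw [← Real.le_log_iff_exp_le hp]
    linarith
  have := h.rv.min_principle hab (fun x hx r hr => by
    rw [h.veq x hx r hr]
    have h1 := h.vp x hx r hr
    have h2 := h.up x hx r hr
    have h3 := h.b2n x r
    have := mul_pos h2 h1
    linarith) hξ0 hξ.2.le hm x hx
  refine le_trans ?_ this
  gcongr
  linarith [hξ.1]

end


section
variable {a b χ M c : ℝ} {u ux uxx ut v vx vxx vt B1 B2 : ℝ → ℝ → ℝ}

lemma Sys.weak_u (h : Sys a b χ M c u ux uxx ut v vx vxx vt B1 B2) {t : ℝ} (ht : 0 < t)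
    {g g' : ℝ → ℝ} (hg : ∀ x ∈ Icc a b, HasDerivAt g (g' x) x)
    (hg' : ContinuousOn g' (Icc a b)) :
    ∫ x in a..b, ut x t * g x = (∫ x in a..b, -((ux x t - χ * (u x t * (vx x t / v x t))) * g' x))
      + ∫ x in a..b, (B1 x t - u x t * v x t) * g x := by
  have hab := h.hab
  have s1 := slice h.rv.c ht
  have s2 := slice h.rv.cx ht
  have s3 := slice h.rv.cxx ht
  have s4 := slice h.ru.c ht
  have s5 := slice h.b1c ht
  have s6 := slice h.ru.cx ht
  have s7 := slice h.ru.cxx ht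
  have s8 : ContinuousOn g (Icc a b) := fun x hx => (hg x hx).continuousAt.continuousWithinAt
  have z0 : ∀ x ∈ Icc a b, v x t ≠ 0 := fun x hx => (h.vp x hx t ht).ne'
  have e := ibp hab (f := fun x => ux x t - χ * (u x t * (vx x t / v x t)))
    (f' := fun x => uxx x t - χ * (ux x t * (vx x t / v x t)
      + u x t * ((vxx x t * v x t - vx x t * vx x t) / (v x t)^2)))
    (g := g) (g' := g')
    (fun x hx => (h.ru.dxx x hx t ht).sub (((h.ru.dx x hx t ht).mul
      ((h.rv.dxx x hx t ht).div (h.rv.dx x hx t ht) (z0 x hx))).const_mul χ))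
    (by
      have z3 : ∀ x ∈ Icc a b, v x t ^ 2 ≠ 0 := fun x hx => pow_ne_zero 2 (z0 x hx)
      fun_prop (disch := assumption)) hg hg'
    (by simp [h.ru.ba t ht, h.rv.ba t ht]) (by simp [h.ru.bb t ht, h.rv.bb t ht])
  rw [intervalIntegral.integral_neg, ← e, ← intervalIntegral.integral_add]
  · refine int_congr hab fun x hx => ?_
    rw [h.ueq x hx t ht]
    have := z0 x hx
    field_simp
    ring
  · refine ii hab ?_
    have z3 : ∀ x ∈ Icc a b, v x t ^ 2 ≠ 0 := fun x hx => pow_ne_zero 2 (z0 x hx)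
    fun_prop (disch := assumption)
  · exact ii hab (by fun_prop)

lemma Sys.weak_v (h : Sys a b χ M c u ux uxx ut v vx vxx vt B1 B2) {t : ℝ} (ht : 0 < t)
    {g g' : ℝ → ℝ} (hg : ∀ x ∈ Icc a b, HasDerivAt g (g' x) x)
    (hg' : ContinuousOn g' (Icc a b)) :
    ∫ x in a..b, vt x t * g x = (∫ x in a..b, -(vx x t * g' x))
      + ∫ x in a..b, (u x t * v x t - v x t + B2 x t) * g x := by
  have hab := h.hab
  have s1 := slice h.rv.c ht
  have s2 := slice h.rv.cx ht
  have s3 := slice h.rv.cxx ht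
  have s4 := slice h.ru.c ht
  have s5 := slice h.b2c ht
  have s8 : ContinuousOn g (Icc a b) := fun x hx => (hg x hx).continuousAt.continuousWithinAt
  have e := ibp hab (f := fun x => vx x t) (f' := fun x => vxx x t) (g := g) (g' := g')
    (fun x hx => h.rv.dxx x hx t ht) s3 hg hg' (h.rv.ba t ht) (h.rv.bb t ht)
  rw [intervalIntegral.integral_neg, ← e, ← intervalIntegral.integral_add]
  · refine int_congr hab fun x hx => ?_
    rw [h.veq x hx t ht]
    ring
  · exact ii hab (by fun_prop)
  · exact ii hab (by fun_prop)

lemma Sys.mass_u (h : Sys a b χ M c u ux uxx ut v vx vxx vt B1 B2) {t : ℝ} (ht : 0 < t) :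
    HasDerivAt (fun s => ∫ x in a..b, u x s)
      ((∫ x in a..b, B1 x t) - ∫ x in a..b, u x t * v x t) t := by
  have hab := h.hab
  have d := deriv_int hab h.ru.c h.ru.ct h.ru.dt ht
  have e := h.weak_u ht (g := fun _ => 1) (g' := fun _ => 0)
    (fun x _ => hasDerivAt_const x 1) continuousOn_const
  simp only [mul_one, mul_zero, neg_zero, intervalIntegral.integral_zero, zero_add] at e
  have s1 := slice h.rv.c ht
  have s4 := slice h.ru.c ht
  have s5 := slice h.b1c ht
  rw [e, intervalIntegral.integral_sub (ii hab (by fun_prop)) (ii hab (by fun_prop))] at d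
  exact d

lemma Sys.mass_v (h : Sys a b χ M c u ux uxx ut v vx vxx vt B1 B2) {t : ℝ} (ht : 0 < t) :
    HasDerivAt (fun s => ∫ x in a..b, v x s)
      ((∫ x in a..b, u x t * v x t) - (∫ x in a..b, v x t) + ∫ x in a..b, B2 x t) t := by
  have hab := h.hab
  have d := deriv_int hab h.rv.c h.rv.ct h.rv.dt ht
  have e := h.weak_v ht (g := fun _ => 1) (g' := fun _ => 0)
    (fun x _ => hasDerivAt_const x 1) continuousOn_const
  simp only [mul_one, mul_zero, neg_zero, intervalIntegral.integral_zero, zero_add] at e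
  have s1 := slice h.rv.c ht
  have s4 := slice h.ru.c ht
  have s5 := slice h.b2c ht
  rw [e, intervalIntegral.integral_add (ii hab (by fun_prop)) (ii hab (by fun_prop)),
    intervalIntegral.integral_sub (ii hab (by fun_prop)) (ii hab (by fun_prop))] at d
  exact d

lemma Sys.uv_ge (h : Sys a b χ M c u ux uxx ut v vx vxx vt B1 B2) {t δ : ℝ} (ht : 0 < t)
    (hδ : ∀ x ∈ Icc a b, δ ≤ v x t) :
    δ * (∫ x in a..b, u x t) ≤ ∫ x in a..b, u x t * v x t := by
  have s1 := slice h.rv.c ht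
  have s4 := slice h.ru.c ht
  rw [← intervalIntegral.integral_const_mul]
  refine int_mono h.hab (by fun_prop) (by fun_prop) fun x hx => ?_
  have := hδ x hx
  have := h.up x hx t ht
  nlinarith

lemma Sys.mass_bdd (h : Sys a b χ M c u ux uxx ut v vx vxx vt B1 B2) {δ : ℝ} (hδ : 0 < δ)
    (hv : ∀ t, 2 ≤ t → ∀ x ∈ Icc a b, δ ≤ v x t) :
    ∃ K, ∀ t, 2 ≤ t → ∫ x in a..b, u x t ≤ K ∧ ∫ x in a..b, v x t ≤ K := by
  have hab := h.hab
  have hb1 : ∀ t, 0 < t → ∫ x in a..b, B1 x t ≤ (b - a) * M := fun t ht =>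
    int_le_const hab (slice h.b1c ht) fun x _ => h.b1m x t
  have hb2 : ∀ t, 0 < t → ∫ x in a..b, B2 x t ≤ (b - a) * M := fun t ht =>
    int_le_const hab (slice h.b2c ht) fun x _ => h.b2m x t
  obtain ⟨K1, hK1⟩ : ∃ K, ∀ t, 2 ≤ t → ∫ x in a..b, u x t ≤ K := by
    refine ⟨max (∫ x in a..b, u x 2) ((b - a) * M / δ + 1),
      barrier (fun t ht => h.mass_u (by linarith)) (le_max_left _ _) ?_⟩
    intro t ht hyt
    have h1 := h.uv_ge (by linarith) (hv t ht)
    have h2 := hb1 t (by linarith)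
    have h3 : (b - a) * M / δ + 1 ≤ ∫ x in a..b, u x t := hyt ▸ le_max_right _ _
    have h4 : δ * ((b - a) * M / δ + 1) ≤ δ * ∫ x in a..b, u x t := by gcongr
    have h5 : δ * ((b - a) * M / δ + 1) = (b - a) * M + δ := by field_simp
    linarith
  obtain ⟨K2, hK2⟩ : ∃ K, ∀ t, 2 ≤ t → (∫ x in a..b, u x t) + ∫ x in a..b, v x t ≤ K := by
    refine ⟨max ((∫ x in a..b, u x 2) + ∫ x in a..b, v x 2) (K1 + 2 * ((b - a) * M) + 1),
      barrier (fun t ht => (h.mass_u (by linarith)).add (h.mass_v (by linarith)))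
        (le_max_left _ _) ?_⟩
    intro t ht hyt
    have hyt' : (∫ x in a..b, u x t) + (∫ x in a..b, v x t)
      = max ((∫ x in a..b, u x 2) + ∫ x in a..b, v x 2) (K1 + 2 * ((b - a) * M) + 1) := hyt
    have h2 := hb1 t (by linarith)
    have h3 := hb2 t (by linarith)
    have h4 := hK1 t ht
    have h5 := le_max_right ((∫ x in a..b, u x 2) + ∫ x in a..b, v x 2)
      (K1 + 2 * ((b - a) * M) + 1)
    linarith
  refine ⟨max K1 K2, fun t ht => ⟨(hK1 t ht).trans (le_max_left _ _), ?_⟩⟩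
  have h1 : 0 ≤ ∫ x in a..b, u x t := int_nonneg hab fun x hx => (h.up x hx t (by linarith)).le
  exact le_trans (by linarith [hK2 t ht]) (le_max_right K1 K2)

/-- the basic estimates -/
structure Enr (a b δ K : ℝ) (u ux v vx : ℝ → ℝ → ℝ) (F F' : ℝ → ℝ) : Prop where
  hδ : 0 < δ
  hK : 1 ≤ K
  low : ∀ t, 2 ≤ t → ∀ x ∈ Icc a b, δ ≤ v x t
  mu : ∀ t, 2 ≤ t → ∫ x in a..b, u x t ≤ K
  mv : ∀ t, 2 ≤ t → ∫ x in a..b, v x t ≤ K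
  dF : ∀ t, 2 ≤ t → HasDerivAt F (F' t) t
  bF : ∀ t, 2 ≤ t → |F t| ≤ K
  dis : ∀ t, 2 ≤ t → (∫ x in a..b, (ux x t / (1 + u x t))^2)
    + (∫ x in a..b, (vx x t / v x t)^2) ≤ F' t + K

lemma Sys.log_v (h : Sys a b χ M c u ux uxx ut v vx vxx vt B1 B2) {t : ℝ} (ht : 0 < t) :
    ∃ d, HasDerivAt (fun s => ∫ x in a..b, Real.log (v x s)) d t ∧
      (∫ x in a..b, (vx x t / v x t)^2) - (b - a) ≤ d := by
  have hab := h.hab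
  have c1 := h.rv.c
  have c2 := h.rv.ct
  have hv0 : ∀ p ∈ Icc a b ×ˢ Ioi (0:ℝ), v p.1 p.2 ≠ 0 := fun p hp =>
    (h.vp p.1 hp.1 p.2 hp.2).ne'
  refine ⟨_, deriv_int hab (F := fun x s => Real.log (v x s))
    (G := fun x s => vt x s / v x s) (by fun_prop (disch := assumption))
    (by fun_prop (disch := assumption))
    (fun x hx s hs => (h.rv.dt x hx s hs).log (h.vp x hx s hs).ne') ht, ?_⟩
  have s1 := slice h.rv.c ht
  have s2 := slice h.rv.cx ht
  have s4 := slice h.ru.c ht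
  have s5 := slice h.b2c ht
  have z0 : ∀ x ∈ Icc a b, v x t ≠ 0 := fun x hx => (h.vp x hx t ht).ne'
  have z3 : ∀ x ∈ Icc a b, v x t ^ 2 ≠ 0 := fun x hx => pow_ne_zero 2 (z0 x hx)
  have e := h.weak_v ht (g := fun x => (v x t)⁻¹) (g' := fun x => -vx x t / (v x t)^2)
    (fun x hx => (h.rv.dx x hx t ht).inv (z0 x hx)) (by fun_prop (disch := assumption))
  have e1 : ∫ x in a..b, vt x t / v x t = ∫ x in a..b, vt x t * (v x t)⁻¹ :=
    int_congr hab fun x _ => by rw [div_eq_mul_inv]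
  have e2 : (∫ x in a..b, (vx x t / v x t)^2)
      = ∫ x in a..b, -(vx x t * (-vx x t / (v x t)^2)) :=
    int_congr hab fun x hx => by
      have := z0 x hx
      field_simp
  have e3 := int_ge_const hab (f := fun x => (u x t * v x t - v x t + B2 x t) * (v x t)⁻¹)
    (K := -1) (by fun_prop (disch := assumption)) (fun x hx => by
      have hp := h.vp x hx t ht
      have hu := h.up x hx t ht
      have hb := h.b2n x t
      have : (u x t * v x t - v x t + B2 x t) * (v x t)⁻¹ = u x t + B2 x t * (v x t)⁻¹ - 1 := by
        field_simp
        ring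
      rw [this]
      have : 0 ≤ B2 x t * (v x t)⁻¹ := by positivity
      linarith)
  rw [e1, e, e2]
  linarith

lemma Sys.log_u (h : Sys a b χ M c u ux uxx ut v vx vxx vt B1 B2) {t : ℝ} (ht : 0 < t) :
    ∃ d, HasDerivAt (fun s => ∫ x in a..b, Real.log (1 + u x s)) d t ∧
      (∫ x in a..b, (ux x t / (1 + u x t))^2) ≤ 2 * d + χ ^ 2 * (∫ x in a..b, (vx x t / v x t)^2)
        + 2 * ∫ x in a..b, v x t := by
  have hab := h.hab
  have c1 := h.ru.c
  have c2 := h.ru.ct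
  have hv0 : ∀ p ∈ Icc a b ×ˢ Ioi (0:ℝ), 1 + u p.1 p.2 ≠ 0 := fun p hp => by
    have := h.up p.1 hp.1 p.2 hp.2
    positivity
  refine ⟨_, deriv_int hab (F := fun x s => Real.log (1 + u x s))
    (G := fun x s => ut x s / (1 + u x s)) (by fun_prop (disch := assumption))
    (by fun_prop (disch := assumption))
    (fun x hx s hs => ((h.ru.dt x hx s hs).const_add 1).log (hv0 (x, s) ⟨hx, hs⟩)) ht, ?_⟩
  have s1 := slice h.rv.c ht
  have s2 := slice h.rv.cx ht
  have s4 := slice h.ru.c ht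
  have s5 := slice h.b1c ht
  have s6 := slice h.ru.cx ht
  have z0 : ∀ x ∈ Icc a b, v x t ≠ 0 := fun x hx => (h.vp x hx t ht).ne'
  have z1 : ∀ x ∈ Icc a b, 1 + u x t ≠ 0 := fun x hx => hv0 (x, t) ⟨hx, ht⟩
  have z3 : ∀ x ∈ Icc a b, (1 + u x t) ^ 2 ≠ 0 := fun x hx => pow_ne_zero 2 (z1 x hx)
  have e := h.weak_u ht (g := fun x => (1 + u x t)⁻¹) (g' := fun x => -ux x t / (1 + u x t)^2)
    (fun x hx => ((h.ru.dx x hx t ht).const_add 1).inv (z1 x hx))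
    (by fun_prop (disch := assumption))
  have e1 : ∫ x in a..b, ut x t / (1 + u x t) = ∫ x in a..b, ut x t * (1 + u x t)⁻¹ :=
    int_congr hab fun x _ => by rw [div_eq_mul_inv]
  have e2 := int_mono hab (f := fun x => (1/2) * (ux x t / (1 + u x t))^2
      + (-(χ^2/2)) * (vx x t / v x t)^2)
    (g := fun x => -((ux x t - χ * (u x t * (vx x t / v x t))) * (-ux x t / (1 + u x t)^2)))
    (by fun_prop (disch := assumption)) (by fun_prop (disch := assumption)) (fun x hx => by
      have hu := h.up x hx t ht
      have h1 := z1 x hx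
      set Q := vx x t / v x t
      set P := ux x t / (1 + u x t) with hP
      set S := u x t / (1 + u x t) with hS
      have hr : -((ux x t - χ * (u x t * Q)) * (-ux x t / (1 + u x t)^2))
        = P^2 - χ * S * P * Q := by
        rw [hP, hS]
        field_simp
      have hS0 : 0 ≤ S := by positivity
      have hS1 : S ≤ 1 := by
        rw [hS, div_le_one (by positivity)]
        linarith
      have hS2 : S ^ 2 ≤ 1 := by nlinarith
      rw [hr]
      have : χ^2 * Q^2 * S^2 ≤ χ^2 * Q^2 * 1 := by gcongr
      nlinarith [sq_nonneg (P - χ * S * Q)])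
  rw [int_lin hab (by fun_prop (disch := assumption)) (by fun_prop (disch := assumption))] at e2
  have e3 := int_mono hab (f := fun x => - v x t)
    (g := fun x => (B1 x t - u x t * v x t) * (1 + u x t)⁻¹)
    (by fun_prop (disch := assumption)) (by fun_prop (disch := assumption)) (fun x hx => by
      have hp := h.vp x hx t ht
      have hu := h.up x hx t ht
      have hb := h.b1n x t
      have e1 : (B1 x t - u x t * v x t) * (1 + u x t)⁻¹
        = - v x t + v x t / (1 + u x t) + B1 x t / (1 + u x t) := by
        field_simp
        ring
      have e2 : 0 ≤ v x t / (1 + u x t) := by positivity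
      have e3 : 0 ≤ B1 x t / (1 + u x t) := by positivity
      rw [e1]
      linarith)
  rw [intervalIntegral.integral_neg] at e3
  rw [e1, e]
  linarith

lemma Sys.energy (h : Sys a b χ M c u ux uxx ut v vx vxx vt B1 B2) :
    ∃ δ K F F', Enr a b δ K u ux v vx F F' := by
  have hab := h.hab
  obtain ⟨δ, hδ, hv⟩ := h.lower
  obtain ⟨K, hK⟩ := h.mass_bdd hδ hv
  choose! du hdu1 hdu2 using fun t (ht : 0 < t) => h.log_u ht
  choose! dv hdv1 hdv2 using fun t (ht : 0 < t) => h.log_v ht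
  have hL : 0 < b - a := sub_pos.2 hab
  set N1 := (2 + (1 + χ^2)) * |K| with hN1
  set N2 := (1 + χ^2) * ((b - a) * |Real.log δ|) with hN2
  set N3 := 2 * |K| + (1 + χ^2) * (b - a) with hN3
  have p1 : 0 ≤ N1 := by positivity
  have p2 : 0 ≤ N2 := by positivity
  have p3 : 0 ≤ N3 := by positivity
  have hK' := le_abs_self K
  refine ⟨δ, 1 + |K| + N1 + N2 + N3,
    fun s => 2 * (∫ x in a..b, Real.log (1 + u x s)) + (1 + χ^2) * ∫ x in a..b, Real.log (v x s),
    fun t => 2 * du t + (1 + χ^2) * dv t, hδ, ?_, hv, ?_, ?_, ?_, ?_, ?_⟩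
  · linarith [abs_nonneg K]
  · intro t ht
    linarith [(hK t ht).1]
  · intro t ht
    linarith [(hK t ht).2, abs_nonneg K]
  · intro t ht
    exact ((hdu1 t (by linarith)).const_mul 2).add ((hdv1 t (by linarith)).const_mul (1 + χ^2))
  · intro t ht
    have ht0 : 0 < t := by linarith
    have s1 := slice h.rv.c ht0
    have s4 := slice h.ru.c ht0
    have z0 : ∀ x ∈ Icc a b, v x t ≠ 0 := fun x hx => (h.vp x hx t ht0).ne'
    have z1 : ∀ x ∈ Icc a b, 1 + u x t ≠ 0 := fun x hx => by
      have := h.up x hx t ht0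
      positivity
    have i1 : 0 ≤ ∫ x in a..b, Real.log (1 + u x t) := int_nonneg hab fun x hx =>
      Real.log_nonneg (by linarith [h.up x hx t ht0])
    have i2 : ∫ x in a..b, Real.log (1 + u x t) ≤ ∫ x in a..b, u x t :=
      int_mono hab (by fun_prop (disch := assumption)) s4 fun x hx => by
        have := h.up x hx t ht0
        have := Real.log_le_sub_one_of_pos (by linarith : 0 < 1 + u x t)
        linarith
    have i3 : ∫ x in a..b, Real.log (v x t) ≤ ∫ x in a..b, v x t :=
      int_mono hab (by fun_prop (disch := assumption)) s1 fun x hx => by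
        have := Real.log_le_sub_one_of_pos (h.vp x hx t ht0)
        linarith
    have i4 : (b - a) * Real.log δ ≤ ∫ x in a..b, Real.log (v x t) :=
      int_ge_const hab (by fun_prop (disch := assumption)) fun x hx =>
        Real.log_le_log hδ (hv t ht x hx)
    have i5 : -((b - a) * |Real.log δ|) ≤ (b - a) * Real.log δ := by
      have := neg_abs_le (Real.log δ)
      nlinarith
    have k1 := (hK t ht).1
    have k2 := (hK t ht).2
    rw [abs_le]
    have q1 : (1 + χ^2) * (∫ x in a..b, Real.log (v x t)) ≤ (1 + χ^2) * |K| := by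
      gcongr
      linarith
    have q2 : (1 + χ^2) * (-((b - a) * |Real.log δ|))
        ≤ (1 + χ^2) * (∫ x in a..b, Real.log (v x t)) := by
      gcongr
      linarith
    have := abs_nonneg K
    constructor
    · rw [show (1 + χ^2) * (-((b - a) * |Real.log δ|)) = - N2 by rw [hN2]; ring] at q2
      linarith
    · have : N1 = 2 * |K| + (1 + χ^2) * |K| := by rw [hN1]; ring
      linarith
  · intro t ht
    have h1 := hdu2 t (by linarith)
    have h2 := hdv2 t (by linarith)
    have k2 := (hK t ht).2
    have q : (1 + χ^2) * ((∫ x in a..b, (vx x t / v x t)^2) - (b - a)) ≤ (1 + χ^2) * dv t := by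
      gcongr
    have := abs_nonneg K
    linarith
end


section
variable {a b χ M c : ℝ} {u ux uxx ut v vx vxx vt B1 B2 : ℝ → ℝ → ℝ} {δ K : ℝ} {F F' : ℝ → ℝ}

/-- one-dimensional Sobolev type inequality -/
lemma sup_sq_le (hab : a < b) {w wx : ℝ → ℝ} (hd : ∀ x ∈ Icc a b, HasDerivAt w (wx x) x)
    (hc : ContinuousOn wx (Icc a b)) (hw : ∀ x ∈ Icc a b, 0 ≤ w x)
    (hK : ∫ x in a..b, w x ≤ K) {x : ℝ} (hx : x ∈ Icc a b) :
    (w x)^2 ≤ 2 * (K / (b - a))^2 + 2 * (b - a) * ∫ z in a..b, (wx z)^2 := by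
  have hL : 0 < b - a := sub_pos.2 hab
  have c0 : ContinuousOn w (Icc a b) := fun x hx => (hd x hx).continuousAt.continuousWithinAt
  obtain ⟨z, hz, hzm⟩ := exists_le_mean hab c0
  have h1 : w z ≤ K / (b - a) := by
    rw [le_div_iff₀ hL]
    linarith
  have h2 := osc_le hab hd hc hx hz
  have h3 := cs hab hc
  have h4 := hw z hz
  have h5 := hw x hx
  set I := ∫ z in a..b, |wx z|
  have h7 : (w x)^2 ≤ (K / (b - a) + I)^2 := by
    apply pow_le_pow_left₀ h5
    linarith
  nlinarith [sq_nonneg (K / (b - a) - I)]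

lemma Enr.good (e : Enr a b δ K u ux v vx F F') {s : ℝ} (hs : 2 ≤ s) :
    ∃ ξ ∈ Ioo s (s + 1), (∫ x in a..b, (ux x ξ / (1 + u x ξ))^2)
      + (∫ x in a..b, (vx x ξ / v x ξ)^2) ≤ 3 * K := by
  obtain ⟨ξ, hξ, hξe⟩ := exists_hasDerivAt_eq_slope F F' (by linarith : s < s + 1)
    (fun r hr => (e.dF r (by linarith [hr.1])).continuousAt.continuousWithinAt)
    (fun r hr => e.dF r (by linarith [hr.1]))
  refine ⟨ξ, hξ, ?_⟩
  have h1 := e.dis ξ (by linarith [hξ.1])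
  rw [hξe, show s + 1 - s = 1 by ring, div_one] at h1
  have h2 := abs_le.1 (e.bF s hs)
  have h3 := abs_le.1 (e.bF (s + 1) (by linarith))
  linarith [h2.1, h3.2]

/-- a Harnack type estimate: bound on the gradient from a bound on the log-gradient -/
lemma harnack (hab : a < b) {w wx : ℝ → ℝ} {A E : ℝ}
    (hd : ∀ x ∈ Icc a b, HasDerivAt w (wx x) x)
    (hc : ContinuousOn wx (Icc a b)) (hw : ∀ x ∈ Icc a b, 0 < w x)
    (hA : ∫ x in a..b, w x ≤ A) (hA0 : 0 ≤ A) (hE : ∫ x in a..b, (wx x / w x)^2 ≤ E) :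
    ∫ x in a..b, (wx x)^2 ≤ (A / (b - a) * Real.exp (((b - a) + E)/2))^2 * E := by
  have hL : 0 < b - a := sub_pos.2 hab
  have c0 : ContinuousOn w (Icc a b) := fun x hx => (hd x hx).continuousAt.continuousWithinAt
  have z0 : ∀ x ∈ Icc a b, w x ≠ 0 := fun x hx => (hw x hx).ne'
  obtain ⟨z, hz, hzm⟩ := exists_le_mean hab c0
  have h1 : w z ≤ A / (b - a) := by
    rw [le_div_iff₀ hL]
    linarith
  have hup : ∀ x ∈ Icc a b, w x ≤ A / (b - a) * Real.exp (((b - a) + E)/2) := by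
    intro x hx
    have h2 := osc_le hab (f := fun x => Real.log (w x)) (f' := fun x => wx x / w x)
      (fun x hx => (hd x hx).log (z0 x hx)) (by fun_prop (disch := assumption)) hx hz
    have h3 := int_abs_le hab (f := fun x => wx x / w x) (by fun_prop (disch := assumption))
    have h4 : Real.log (w x) ≤ Real.log (w z) + ((b - a) + E)/2 := by
      linarith
    rw [Real.log_le_iff_le_exp (hw x hx), Real.exp_add, Real.exp_log (hw z hz)] at h4
    exact h4.trans (by gcongr)
  set G := A / (b - a) * Real.exp (((b - a) + E)/2)
  have hG : 0 ≤ G := by positivity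
  have i1 := int_mono hab (f := fun x => (wx x)^2) (g := fun x => G^2 * (wx x / w x)^2)
    (by fun_prop) (by fun_prop (disch := assumption)) (fun x hx => by
      have := hw x hx
      have h2 := hup x hx
      have h3 : (wx x)^2 = (w x)^2 * (wx x / w x)^2 := by
        field_simp
      rw [h3]
      gcongr)
  rw [intervalIntegral.integral_const_mul] at i1
  exact i1.trans (by gcongr)

/-- bounded gradients at good times -/
lemma Sys.good_time (h : Sys a b χ M c u ux uxx ut v vx vxx vt B1 B2)
    (e : Enr a b δ K u ux v vx F F') :
    ∃ Y, 0 ≤ Y ∧ ∀ s, 2 ≤ s → ∃ ξ ∈ Ioo s (s + 1), (∫ x in a..b, (ux x ξ)^2) ≤ Y ∧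
      (∫ x in a..b, (vx x ξ)^2) ≤ Y := by
  have hab := h.hab
  have hL : 0 < b - a := sub_pos.2 hab
  have hK0 := e.hK
  set A := (b - a) + K with hA
  refine ⟨(A / (b - a) * Real.exp (((b - a) + 3 * K)/2))^2 * (3 * K), by positivity, ?_⟩
  intro s hs
  obtain ⟨ξ, hξ, hξe⟩ := e.good hs
  have hξ2 : 2 ≤ ξ := by linarith [hξ.1]
  have hξ0 : 0 < ξ := by linarith
  have n1 : 0 ≤ ∫ x in a..b, (ux x ξ / (1 + u x ξ))^2 := int_nonneg hab fun x _ => sq_nonneg _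
  have n2 : 0 ≤ ∫ x in a..b, (vx x ξ / v x ξ)^2 := int_nonneg hab fun x _ => sq_nonneg _
  refine ⟨ξ, hξ, ?_, ?_⟩
  · refine harnack hab (w := fun x => 1 + u x ξ) (wx := fun x => ux x ξ)
      (fun x hx => (h.ru.dx x hx ξ hξ0).const_add 1) (slice h.ru.cx hξ0)
      (fun x hx => by linarith [h.up x hx ξ hξ0]) ?_ (by positivity) (by linarith)
    rw [intervalIntegral.integral_add (by simp) (ii hab (slice h.ru.c hξ0))]
    simp only [intervalIntegral.integral_const, smul_eq_mul, mul_one]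
    have := e.mu ξ hξ2
    linarith
  · refine harnack hab (w := fun x => v x ξ) (wx := fun x => vx x ξ)
      (fun x hx => (h.rv.dx x hx ξ hξ0)) (slice h.rv.cx hξ0)
      (fun x hx => h.vp x hx ξ hξ0) ?_ (by positivity) (by linarith)
    have := e.mv ξ hξ2
    linarith

lemma Sys.u_sq (h : Sys a b χ M c u ux uxx ut v vx vxx vt B1 B2)
    (e : Enr a b δ K u ux v vx F F') {t : ℝ} (ht : 2 ≤ t) :
    ∫ x in a..b, (u x t)^2 ≤ K * (2 * (K / (b - a)) + 1
      + ((b - a) + K) * ∫ x in a..b, (ux x t / (1 + u x t))^2) := by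
  have hab := h.hab
  have hL : 0 < b - a := sub_pos.2 hab
  have hK0 := e.hK
  have ht0 : 0 < t := by linarith
  have s4 := slice h.ru.c ht0
  have s6 := slice h.ru.cx ht0
  have z1 : ∀ x ∈ Icc a b, 1 + u x t ≠ 0 := fun x hx => by
    have := h.up x hx t ht0
    positivity
  obtain ⟨m, hm, hmax⟩ := isCompact_Icc.exists_isMaxOn (nonempty_Icc.2 hab.le) s4
  have hmax' : ∀ x ∈ Icc a b, u x t ≤ u m t := fun x hx => hmax hx
  obtain ⟨z, hz, hzm⟩ := exists_le_mean hab s4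
  have h1 : u z t ≤ K / (b - a) := by
    rw [le_div_iff₀ hL]
    linarith [e.mu t ht]
  have h2 := osc_le hab (fun x hx => h.ru.dx x hx t ht0) s6 hm hz
  set η := (b - a) + K with hη
  have hη0 : 0 < η := by positivity
  set T := u m t with hT
  have hT0 : 0 < T := h.up m hm t ht0
  have i1 := int_mono hab (f := fun x => |ux x t|)
    (g := fun x => (η/2) * (ux x t / (1 + u x t))^2 + ((1 + T) / (2 * η)) * (1 + u x t))
    (by fun_prop) (by fun_prop (disch := assumption)) (fun x hx => by
      have hu := h.up x hx t ht0
      have hle := hmax' x hx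
      set P := ux x t / (1 + u x t) with hP
      have e1 : |ux x t| = |P| * (1 + u x t) := by
        rw [hP, abs_div, abs_of_pos (by linarith : 0 < 1 + u x t)]
        field_simp
      have e2 : (1 + u x t) * (1 + u x t) ≤ (1 + T) * (1 + u x t) := by gcongr
      have e3 : |P| * (1 + u x t) ≤ (η/2) * P^2 + (1 / (2 * η)) * ((1 + u x t) * (1 + u x t)) := by
        have := sq_abs P
        have h4 : (η/2) * P^2 + (1 / (2 * η)) * ((1 + u x t) * (1 + u x t)) - |P| * (1 + u x t)
          = (1 / (2 * η)) * (η * |P| - (1 + u x t))^2 := by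
          rw [← this]
          field_simp
          ring
        have h5 : 0 ≤ (1 / (2 * η)) * (η * |P| - (1 + u x t))^2 := by positivity
        linarith
      have e4 : (1 / (2 * η)) * ((1 + u x t) * (1 + u x t))
          ≤ (1 / (2 * η)) * ((1 + T) * (1 + u x t)) := by gcongr
      have e5 : (1 / (2 * η)) * ((1 + T) * (1 + u x t)) = ((1 + T) / (2 * η)) * (1 + u x t) := by
        ring
      rw [e1]
      linarith)
  rw [int_lin hab (by fun_prop (disch := assumption)) (by fun_prop),
    intervalIntegral.integral_add (by simp) (ii hab s4)] at i1
  simp only [intervalIntegral.integral_const, smul_eq_mul, mul_one] at i1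
  have i2 : (1 + T) / (2 * η) * ((b - a) + ∫ x in a..b, u x t) ≤ (1 + T) / (2 * η) * η := by
    have := e.mu t ht
    gcongr
    linarith
  have i3 : (1 + T) / (2 * η) * η = (1 + T) / 2 := by field_simp
  have i4 : T ≤ 2 * (K / (b - a)) + 1 + η * ∫ x in a..b, (ux x t / (1 + u x t))^2 := by
    have : T - u z t ≤ ∫ x in a..b, |ux x t| := h2
    linarith
  have i5 := int_mono hab (f := fun x => (u x t)^2) (g := fun x => T * u x t) (by fun_prop)
    (by fun_prop) (fun x hx => by
      have hu := h.up x hx t ht0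
      have hle := hmax' x hx
      nlinarith)
  rw [intervalIntegral.integral_const_mul] at i5
  calc ∫ x in a..b, (u x t)^2 ≤ T * ∫ x in a..b, u x t := i5
    _ ≤ T * K := by
      have := e.mu t ht
      gcongr
    _ = K * T := mul_comm _ _
    _ ≤ _ := by gcongr

lemma Sys.M_nonneg (h : Sys a b χ M c u ux uxx ut v vx vxx vt B1 B2) : 0 ≤ M :=
  (h.b1n 0 0).trans (h.b1m 0 0)

set_option maxHeartbeats 1600000 in
lemma Sys.y_est (h : Sys a b χ M c u ux uxx ut v vx vxx vt B1 B2)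
    (e : Enr a b δ K u ux v vx F F') :
    ∃ C, 0 ≤ C ∧ ∀ t, 2 ≤ t → (∫ x in a..b, -(2 * (vt x t * vxx x t)))
      + (∫ x in a..b, (vxx x t)^2) ≤ C * (1 + ∫ x in a..b, (vx x t)^2) * (F' t + (1 + K)) := by
  have hab := h.hab
  have hL : 0 < b - a := sub_pos.2 hab
  have hK0 := e.hK
  have hM := h.M_nonneg
  set L := b - a with hLdef
  set A1 := 2 * (K / L)^2 + 2 * L with hA1
  set A2 := K * (2 * (K / L) + 1 + (L + K)) with hA2
  have hA10 : 0 ≤ A1 := by positivity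
  have hA20 : 0 ≤ A2 := by positivity
  refine ⟨3 * (A1 * (A2 + L) + L * M^2), by positivity, ?_⟩
  intro t ht
  have ht0 : 0 < t := by linarith
  have s1 := slice h.rv.c ht0
  have s3 := slice h.rv.cxx ht0
  have s4 := slice h.ru.c ht0
  have s5 := slice h.rv.ct ht0
  set y := ∫ x in a..b, (vx x t)^2 with hy
  have hy0 : 0 ≤ y := int_nonneg hab fun x _ => sq_nonneg _
  set D := ∫ x in a..b, (ux x t / (1 + u x t))^2 with hD
  have hD0 : 0 ≤ D := int_nonneg hab fun x _ => sq_nonneg _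
  have hDF : 1 + D ≤ F' t + (1 + K) := by
    have h1 := e.dis t ht
    have n2 : 0 ≤ ∫ x in a..b, (vx x t / v x t)^2 := int_nonneg hab fun x _ => sq_nonneg _
    linarith
  have hS : ∀ x ∈ Icc a b, (v x t)^2 ≤ A1 * (1 + y) := by
    intro x hx
    have h1 := sup_sq_le hab (fun x hx => h.rv.dx x hx t ht0) (slice h.rv.cx ht0)
      (fun x hx => (h.vp x hx t ht0).le) (e.mv t ht) hx
    have h2 : 0 ≤ 2 * (K / L)^2 * y := by positivity
    rw [← hy] at h1
    rw [hA1]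
    nlinarith
  have hu2 : ∫ x in a..b, (u x t)^2 ≤ A2 * (1 + D) := by
    have h1 := h.u_sq e ht
    refine h1.trans ?_
    rw [hA2, mul_assoc]
    have : 0 ≤ K / L := by positivity
    gcongr
    nlinarith
  set S := A1 * (1 + y) with hSdef
  have hS0 : 0 ≤ S := by positivity
  have i1 := int_mono hab (f := fun x => 1 * (-(2 * (vt x t * vxx x t))) + 1 * (vxx x t)^2)
    (g := fun x => 3 * S * (u x t)^2 + 1 * (3 * S + 3 * M^2))
    (by fun_prop) (by fun_prop) (fun x hx => by
      have hv2 := hS x hx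
      have hb0 := h.b2n x t
      have hb1 := h.b2m x t
      have hb2 : (B2 x t)^2 ≤ M^2 := by gcongr
      rw [h.veq x hx t ht0]
      have e1 : (u x t)^2 * (v x t)^2 ≤ (u x t)^2 * S := by gcongr
      set g := u x t * v x t - v x t + B2 x t with hg
      have e2 : g^2 ≤ 3 * ((u x t * v x t)^2 + (v x t)^2 + (B2 x t)^2) := by
        rw [hg]
        nlinarith [sq_nonneg (u x t * v x t + v x t), sq_nonneg (v x t + B2 x t),
          sq_nonneg (u x t * v x t - B2 x t)]
      have e3 : vxx x t + u x t * v x t - v x t + B2 x t = vxx x t + g := by rw [hg]; ring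
      rw [e3]
      have e4 : (u x t * v x t)^2 = (u x t)^2 * (v x t)^2 := by ring
      nlinarith [sq_nonneg (vxx x t + g), sq_nonneg (vxx x t)])
  rw [int_lin hab (by fun_prop) (by fun_prop), int_lin hab (by fun_prop) (by fun_prop)] at i1
  simp only [intervalIntegral.integral_const, smul_eq_mul, one_mul] at i1
  have i2 : 3 * S * (∫ x in a..b, (u x t)^2) ≤ 3 * S * (A2 * (1 + D)) := by gcongr
  have i3 : 3 * S * (A2 * (1 + D)) + L * (3 * S + 3 * M^2)
      ≤ 3 * (A1 * (A2 + L) + L * M^2) * (1 + y) * (1 + D) := by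
    have q1 : 0 ≤ A1 * L * (1 + y) * D := by positivity
    have q2 : 0 ≤ L * M^2 * ((1 + y) * (1 + D) - 1) := by
      have : 0 ≤ (1 + y) * (1 + D) - 1 := by nlinarith
      positivity
    have q3 : 3 * (A1 * (A2 + L) + L * M^2) * (1 + y) * (1 + D)
        = 3 * (A1 * (1 + y)) * (A2 * (1 + D)) + L * (3 * (A1 * (1 + y)) + 3 * M^2)
          + 3 * (A1 * L * (1 + y) * D) + 3 * (L * M^2 * ((1 + y) * (1 + D) - 1)) := by ring
    rw [hSdef, q3]
    linarith only [q1, q2]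
  have i4 : 3 * (A1 * (A2 + L) + L * M^2) * (1 + y) * (1 + D)
      ≤ 3 * (A1 * (A2 + L) + L * M^2) * (1 + y) * (F' t + (1 + K)) := by gcongr
  linarith

/-- Gronwall in logarithmic form -/
lemma gron {y y' G G' : ℝ → ℝ} {C s t : ℝ} (hst : s ≤ t)
    (hy : ∀ r ∈ Icc s t, HasDerivAt y (y' r) r) (hG : ∀ r ∈ Icc s t, HasDerivAt G (G' r) r)
    (h0 : ∀ r ∈ Icc s t, 0 ≤ y r) (h : ∀ r ∈ Icc s t, y' r ≤ C * (1 + y r) * G' r) :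
    y t ≤ (1 + y s) * Real.exp (C * (G t - G s)) := by
  have h1 := anti (y := fun r => Real.log (1 + y r) - C * G r)
    (y' := fun r => y' r / (1 + y r) - C * G' r) hst
    (fun r hr => (((hy r hr).const_add 1).log (by have := h0 r hr; positivity)).sub
      ((hG r hr).const_mul C)) (fun r hr => by
        have h2 := h0 r hr
        have h3 := h r hr
        rw [sub_nonpos, div_le_iff₀ (by positivity)]
        linarith)
  have ps := h0 s (left_mem_Icc.2 hst)
  have pt := h0 t (right_mem_Icc.2 hst)
  have h2 : Real.log (1 + y t) ≤ Real.log (1 + y s) + C * (G t - G s) := by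
    linarith
  rw [Real.log_le_iff_le_exp (by positivity), Real.exp_add, Real.exp_log (by positivity)] at h2
  linarith

lemma Sys.y_bdd (h : Sys a b χ M c u ux uxx ut v vx vxx vt B1 B2)
    (e : Enr a b δ K u ux v vx F F') :
    ∃ Y, 0 ≤ Y ∧ ∀ t, 3 ≤ t → (∫ x in a..b, (vx x t)^2) ≤ Y := by
  have hab := h.hab
  have hK0 := e.hK
  obtain ⟨Y0, hY0, hgood⟩ := h.good_time e
  obtain ⟨C, hC, hest⟩ := h.y_est e
  refine ⟨(1 + Y0) * Real.exp (C * (2 * K + (1 + K))), by positivity, ?_⟩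
  intro t ht
  obtain ⟨ξ, hξ, -, hξ2⟩ := hgood (t - 1) (by linarith)
  rw [sub_add_cancel] at hξ
  have hξ2' : 2 ≤ ξ := by linarith [hξ.1]
  have h1 := gron (y := fun s => ∫ x in a..b, (vx x s)^2)
    (y' := fun t => ∫ x in a..b, -(2 * (vt x t * vxx x t))) (G := fun t => F t + (1 + K) * t)
    (G' := fun t => F' t + (1 + K) * 1) (C := C) hξ.2.le
    (fun r hr => h.rv.deriv_sq hab (by linarith [hr.1]))
    (fun r hr => (e.dF r (by linarith [hr.1])).add ((hasDerivAt_id r).const_mul (1 + K)))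
    (fun r _ => int_nonneg hab fun x _ => sq_nonneg _)
    (fun r hr => by
      have h2 := hest r (by linarith [hr.1])
      have h3 : 0 ≤ ∫ x in a..b, (vxx x r)^2 := int_nonneg hab fun x _ => sq_nonneg _
      rw [mul_one]
      linarith)
  refine h1.trans ?_
  have hp : 0 ≤ ∫ x in a..b, (vx x ξ)^2 := int_nonneg hab fun x _ => sq_nonneg _
  have b1 := abs_le.1 (e.bF t (by linarith))
  have b2 := abs_le.1 (e.bF ξ hξ2')
  have hle : F t + (1 + K) * t - (F ξ + (1 + K) * ξ) ≤ 2 * K + (1 + K) := by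
    nlinarith [hξ.1]
  gcongr

set_option maxHeartbeats 1600000 in
lemma Sys.w_est (h : Sys a b χ M c u ux uxx ut v vx vxx vt B1 B2)
    (e : Enr a b δ K u ux v vx F F') {Y : ℝ} (hY0 : 0 ≤ Y)
    (hY : ∀ t, 3 ≤ t → (∫ x in a..b, (vx x t)^2) ≤ Y) :
    ∃ C, 0 ≤ C ∧ ∀ t, 3 ≤ t → (∫ x in a..b, -(2 * (ut x t * uxx x t)))
      ≤ C * (1 + ∫ x in a..b, (ux x t)^2) * (1 + ∫ x in a..b, (vxx x t)^2) := by
  have hab := h.hab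
  have hL : 0 < b - a := sub_pos.2 hab
  have hK0 := e.hK
  have hM := h.M_nonneg
  have hδ := e.hδ
  set L := b - a with hLdef
  set A1 := 2 * (K / L)^2 + 2 * L with hA1
  set A2 := L / δ^2 with hA2
  set Sv := A1 * (1 + Y) with hSv
  have hA10 : 0 ≤ A1 := by positivity
  have hA20 : 0 ≤ A2 := by positivity
  have hSv0 : 0 ≤ Sv := by positivity
  refine ⟨9 * χ^2 * (A2 + A1 / δ^2 + A1 * A2 * Y / δ^2) + 3 * L * (A1 * Sv + M^2),
    by positivity, ?_⟩
  intro t ht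
  have ht2 : 2 ≤ t := by linarith
  have ht0 : 0 < t := by linarith
  have s1 := slice h.rv.c ht0
  have s2 := slice h.rv.cx ht0
  have s3 := slice h.rv.cxx ht0
  have s4 := slice h.ru.c ht0
  have s5 := slice h.ru.ct ht0
  have s6 := slice h.ru.cx ht0
  have s7 := slice h.ru.cxx ht0
  set y := ∫ x in a..b, (vx x t)^2 with hy
  have hy0 : 0 ≤ y := int_nonneg hab fun x _ => sq_nonneg _
  set w := ∫ x in a..b, (ux x t)^2 with hw
  have hw0 : 0 ≤ w := int_nonneg hab fun x _ => sq_nonneg _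
  set Z := ∫ x in a..b, (vxx x t)^2 with hZ
  have hZ0 : 0 ≤ Z := int_nonneg hab fun x _ => sq_nonneg _
  have hyY : y ≤ Y := hY t ht
  have hSV : ∀ x ∈ Icc a b, (v x t)^2 ≤ Sv := by
    intro x hx
    have h1 := sup_sq_le hab (fun x hx => h.rv.dx x hx t ht0) (slice h.rv.cx ht0)
      (fun x hx => (h.vp x hx t ht0).le) (e.mv t ht2) hx
    have h2 : 0 ≤ 2 * (K / L)^2 * Y := by positivity
    rw [← hy] at h1
    rw [hSv, hA1]
    nlinarith
  have hSU : ∀ x ∈ Icc a b, (u x t)^2 ≤ A1 * (1 + w) := by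
    intro x hx
    have h1 := sup_sq_le hab (fun x hx => h.ru.dx x hx t ht0) (slice h.ru.cx ht0)
      (fun x hx => (h.up x hx t ht0).le) (e.mu t ht2) hx
    have h2 : 0 ≤ 2 * (K / L)^2 * w := by positivity
    rw [← hw] at h1
    rw [hA1]
    nlinarith
  have hvx : ∀ x ∈ Icc a b, (vx x t)^2 ≤ L * Z := by
    intro x hx
    have am : a ∈ Icc a b := left_mem_Icc.2 hab.le
    have h1 := osc_le hab (fun x hx => h.rv.dxx x hx t ht0) s3 hx am
    have h2 := osc_le hab (fun x hx => h.rv.dxx x hx t ht0) s3 am hx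
    rw [h.rv.ba t ht0] at h1 h2
    have h3 := cs hab s3
    refine le_trans ?_ h3
    rw [sq_le_sq]
    refine le_trans ?_ (le_abs_self _)
    rw [abs_le]
    constructor <;> linarith
  have hQ : ∀ x ∈ Icc a b, (vx x t / v x t)^2 ≤ (vx x t)^2 / δ^2 := by
    intro x hx
    have := e.low t ht2 x hx
    rw [div_pow]
    gcongr
  set Su := A1 * (1 + w) with hSu
  have hSu0 : 0 ≤ Su := by positivity
  set q := A2 * Z with hq
  have hq0 : 0 ≤ q := by positivity
  have hQ2 : ∀ x ∈ Icc a b, (vx x t / v x t)^2 ≤ q := by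
    intro x hx
    refine (hQ x hx).trans ?_
    have h1 : q = (L * Z) / δ^2 := by rw [hq, hA2]; ring
    rw [h1]
    have := hvx x hx
    gcongr
  have i1 := int_mono hab (f := fun x => -(2 * (ut x t * uxx x t)))
    (g := fun x => 1 * (9 * χ^2 * q * (ux x t)^2 + (9 * χ^2 * (Su / δ^2)) * (vxx x t)^2)
      + 1 * ((9 * χ^2 * (Su * q / δ^2)) * (vx x t)^2 + 3 * (Su * Sv + M^2) * 1))
    (by fun_prop) (by fun_prop) (fun x hx => by
      have hv2 := hSV x hx
      have hu2 := hSU x hx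
      have hb0 := h.b1n x t
      have hb1 := h.b1m x t
      have hb2 : (B1 x t)^2 ≤ M^2 := by gcongr
      have hlow := e.low t ht2 x hx
      have hq1 := hQ x hx
      have hq2 := hQ2 x hx
      rw [h.ueq x hx t ht0]
      set Q := vx x t / v x t with hQd
      set X1 := ux x t * Q with hX1
      set X2 := u x t * (vxx x t / v x t) with hX2
      set X3 := u x t * Q^2 with hX3
      have e1 : X1^2 ≤ q * (ux x t)^2 := by
        rw [hX1, mul_pow, mul_comm]
        gcongr
      have e2 : X2^2 ≤ (Su / δ^2) * (vxx x t)^2 := by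
        have k1 : X2^2 = (u x t)^2 * ((vxx x t)^2 / (v x t)^2) := by rw [hX2]; ring
        have k2 : (Su / δ^2) * (vxx x t)^2 = Su * ((vxx x t)^2 / δ^2) := by ring
        rw [k1, k2]
        gcongr
      have e3 : X3^2 ≤ (Su * q / δ^2) * (vx x t)^2 := by
        have k1 : X3^2 = (u x t)^2 * (Q^2 * Q^2) := by rw [hX3]; ring
        have k2 : (Su * q / δ^2) * (vx x t)^2 = Su * (q * ((vx x t)^2 / δ^2)) := by ring
        rw [k1, k2]
        gcongr
      have e4 : (u x t * v x t)^2 ≤ Su * Sv := by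
        rw [mul_pow]
        gcongr
      set X := X1 + X2 - X3 with hX
      have e5 : X^2 ≤ 3 * (X1^2 + X2^2 + X3^2) := by
        rw [hX]
        nlinarith [sq_nonneg (X1 - X2), sq_nonneg (X1 + X3), sq_nonneg (X2 + X3)]
      set g := χ * X + u x t * v x t - B1 x t with hg
      have e6 : g^2 ≤ 3 * (χ^2 * X^2 + (u x t * v x t)^2 + (B1 x t)^2) := by
        rw [hg]
        have e61 : 3 * (χ^2 * X^2 + (u x t * v x t)^2 + (B1 x t)^2)
            = (χ * X + u x t * v x t - B1 x t)^2 + (χ * X - u x t * v x t)^2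
              + (χ * X + B1 x t)^2 + (u x t * v x t + B1 x t)^2 := by ring
        rw [e61]
        linarith only [sq_nonneg (χ * X - u x t * v x t), sq_nonneg (χ * X + B1 x t),
          sq_nonneg (u x t * v x t + B1 x t)]
      have e7 : uxx x t - χ * X - u x t * v x t + B1 x t = uxx x t - g := by rw [hg]; ring
      rw [e7]
      have e8 : -(2 * ((uxx x t - g) * uxx x t)) ≤ g^2 := by
        have e81 : g^2 = -(2 * ((uxx x t - g) * uxx x t)) + (uxx x t - g)^2 + (uxx x t)^2 := by ring
        linarith only [e81, sq_nonneg (uxx x t - g), sq_nonneg (uxx x t)]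
      have e9 : X^2 ≤ 3 * (q * (ux x t)^2 + (Su / δ^2) * (vxx x t)^2
        + (Su * q / δ^2) * (vx x t)^2) := by linarith
      have e10 : χ^2 * X^2 ≤ χ^2 * (3 * (q * (ux x t)^2 + (Su / δ^2) * (vxx x t)^2
        + (Su * q / δ^2) * (vx x t)^2)) := by gcongr
      linarith)
  rw [int_lin hab (by fun_prop) (by fun_prop), int_lin hab (by fun_prop) (by fun_prop),
    int_lin hab (by fun_prop) (by fun_prop)] at i1
  simp only [intervalIntegral.integral_const, smul_eq_mul, mul_one, one_mul] at i1
  rw [← hw, ← hZ, ← hy, ← hLdef] at i1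
  refine i1.trans ?_
  have W1 : w ≤ 1 + w := by linarith
  have Z1 : Z ≤ 1 + Z := by linarith
  have k1 : 9 * χ^2 * q * w ≤ 9 * χ^2 * A2 * ((1 + w) * (1 + Z)) := by
    rw [hq]
    calc 9 * χ^2 * (A2 * Z) * w = 9 * χ^2 * A2 * (w * Z) := by ring
      _ ≤ _ := by gcongr
  have k2 : 9 * χ^2 * (Su / δ^2) * Z ≤ 9 * χ^2 * (A1 / δ^2) * ((1 + w) * (1 + Z)) := by
    rw [hSu]
    calc 9 * χ^2 * (A1 * (1 + w) / δ^2) * Z = 9 * χ^2 * (A1 / δ^2) * ((1 + w) * Z) := by ring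
      _ ≤ _ := by gcongr
  have k3 : 9 * χ^2 * (Su * q / δ^2) * y
      ≤ 9 * χ^2 * (A1 * A2 * Y / δ^2) * ((1 + w) * (1 + Z)) := by
    rw [hSu, hq]
    calc 9 * χ^2 * (A1 * (1 + w) * (A2 * Z) / δ^2) * y
        = 9 * χ^2 * (A1 * A2 * y / δ^2) * ((1 + w) * Z) := by ring
      _ ≤ _ := by gcongr
  have k4 : L * (3 * (Su * Sv + M^2)) ≤ 3 * L * (A1 * Sv + M^2) * ((1 + w) * (1 + Z)) := by
    rw [hSu]
    have q1 : 0 ≤ 3 * L * (A1 * Sv * (1 + w) * Z) := by positivity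
    have q2 : 0 ≤ 3 * L * (M^2 * (w + Z + w * Z)) := by positivity
    linarith
  have k5 : 3 * (Su * Sv + M^2) * L = L * (3 * (Su * Sv + M^2)) := by ring
  have : (9 * χ^2 * (A2 + A1 / δ^2 + A1 * A2 * Y / δ^2) + 3 * L * (A1 * Sv + M^2)) * (1 + w)
      * (1 + Z) = 9 * χ^2 * A2 * ((1 + w) * (1 + Z)) + 9 * χ^2 * (A1 / δ^2) * ((1 + w) * (1 + Z))
      + 9 * χ^2 * (A1 * A2 * Y / δ^2) * ((1 + w) * (1 + Z))
      + 3 * L * (A1 * Sv + M^2) * ((1 + w) * (1 + Z)) := by ring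
  rw [this]
  linarith

lemma Sys.w_bdd (h : Sys a b χ M c u ux uxx ut v vx vxx vt B1 B2)
    (e : Enr a b δ K u ux v vx F F') :
    ∃ Y, 0 ≤ Y ∧ ∀ t, 4 ≤ t → (∫ x in a..b, (ux x t)^2) ≤ Y ∧ (∫ x in a..b, (vx x t)^2) ≤ Y := by
  have hab := h.hab
  have hK0 := e.hK
  obtain ⟨Y0, hY0, hgood⟩ := h.good_time e
  obtain ⟨C1, hC1, hest1⟩ := h.y_est e
  obtain ⟨Y, hYn, hY⟩ := h.y_bdd e
  obtain ⟨C2, hC2, hest2⟩ := h.w_est e hYn hY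
  set H := C1 * (1 + Y) with hH
  have hH0 : 0 ≤ H := by positivity
  refine ⟨max Y ((1 + Y0) * Real.exp (C2 * (1 + H * (2 * K + (1 + K)) + Y))),
    le_trans hYn (le_max_left _ _), ?_⟩
  intro t ht
  refine ⟨le_trans ?_ (le_max_right _ _), (hY t (by linarith)).trans (le_max_left _ _)⟩
  obtain ⟨ξ, hξ, hξ2, -⟩ := hgood (t - 1) (by linarith)
  rw [sub_add_cancel] at hξ
  have hξ3 : 3 ≤ ξ := by linarith [hξ.1]
  have h1 := gron (y := fun s => ∫ x in a..b, (ux x s)^2)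
    (y' := fun t => ∫ x in a..b, -(2 * (ut x t * uxx x t)))
    (G := fun t => t + H * (F t + (1 + K) * t) - ∫ x in a..b, (vx x t)^2)
    (G' := fun t => 1 + H * (F' t + (1 + K) * 1) - ∫ x in a..b, -(2 * (vt x t * vxx x t)))
    (C := C2) hξ.2.le
    (fun r hr => h.ru.deriv_sq hab (by linarith [hr.1]))
    (fun r hr => ((hasDerivAt_id r).add (((e.dF r (by linarith [hr.1])).add
      ((hasDerivAt_id r).const_mul (1 + K))).const_mul H)).sub
      (h.rv.deriv_sq hab (by linarith [hr.1])))
    (fun r _ => int_nonneg hab fun x _ => sq_nonneg _)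
    (fun r hr => by
      have hr3 : 3 ≤ r := by linarith [hr.1]
      refine (hest2 r hr3).trans ?_
      have h0 : 0 ≤ ∫ x in a..b, (ux x r)^2 := int_nonneg hab fun x _ => sq_nonneg _
      have h2 := hest1 r (by linarith)
      have h3 := hY r hr3
      have h4 : 0 ≤ F' r + (1 + K) := by
        have h5 := e.dis r (by linarith)
        have n1 : 0 ≤ ∫ x in a..b, (ux x r / (1 + u x r))^2 :=
          int_nonneg hab fun x _ => sq_nonneg _
        have n2 : 0 ≤ ∫ x in a..b, (vx x r / v x r)^2 := int_nonneg hab fun x _ => sq_nonneg _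
        linarith
      have h6 : C1 * (1 + ∫ x in a..b, (vx x r)^2) * (F' r + (1 + K))
          ≤ H * (F' r + (1 + K)) := by
        rw [hH]
        gcongr
      rw [mul_one]
      gcongr
      linarith)
  refine h1.trans ?_
  have hp : 0 ≤ ∫ x in a..b, (ux x ξ)^2 := int_nonneg hab fun x _ => sq_nonneg _
  have hp2 : 0 ≤ ∫ x in a..b, (vx x t)^2 := int_nonneg hab fun x _ => sq_nonneg _
  have b1 := abs_le.1 (e.bF t (by linarith))
  have b2 := abs_le.1 (e.bF ξ (by linarith))
  have b3 := hY ξ hξ3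
  have hle : F t + (1 + K) * t - (F ξ + (1 + K) * ξ) ≤ 2 * K + (1 + K) := by
    nlinarith [hξ.1]
  have hle2 : H * (F t + (1 + K) * t - (F ξ + (1 + K) * ξ)) ≤ H * (2 * K + (1 + K)) := by gcongr
  gcongr
  linarith [hξ.1]

end

section
variable {a b χ M c δ K : ℝ} {u ux uxx ut v vx vxx vt B1 B2 : ℝ → ℝ → ℝ} {F F' : ℝ → ℝ}

lemma Sys.sup_bdd (h : Sys a b χ M c u ux uxx ut v vx vxx vt B1 B2) :
    ∃ δ K Y C : ℝ, 0 < δ ∧ 1 ≤ C ∧ 0 ≤ K ∧ 0 ≤ Y ∧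
      (∀ t, 2 ≤ t → ∀ x ∈ Icc a b, δ ≤ v x t) ∧ (∀ t, 2 ≤ t → ∫ x in a..b, u x t ≤ K) ∧
      (∀ t, 4 ≤ t → ∀ x ∈ Icc a b, u x t ≤ C ∧ v x t ≤ C) ∧
      (∀ t, 4 ≤ t → (∫ x in a..b, (ux x t)^2) ≤ Y) := by
  obtain ⟨δ, K, F, F', e⟩ := h.energy
  obtain ⟨Y, hY0, hY⟩ := h.w_bdd e
  have hab := h.hab
  have hL : 0 < b - a := sub_pos.2 hab
  have hK := e.hK
  refine ⟨δ, K, Y, 1 + (2 * (K / (b - a))^2 + 2 * (b - a) * Y), e.hδ, ?_, by linarith, hY0, e.low,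
    e.mu, ?_, fun t ht => (hY t ht).1⟩
  · have : 0 ≤ 2 * (K / (b - a))^2 + 2 * (b - a) * Y := by positivity
    linarith
  · intro t ht x hx
    have ht0 : 0 < t := by linarith
    have ht2 : 2 ≤ t := by linarith
    have h1 := sup_sq_le hab (fun x hx => h.ru.dx x hx t ht0) (slice h.ru.cx ht0)
      (fun x hx => (h.up x hx t ht0).le) (e.mu t ht2) hx
    have h2 := sup_sq_le hab (fun x hx => h.rv.dx x hx t ht0) (slice h.rv.cx ht0)
      (fun x hx => (h.vp x hx t ht0).le) (e.mv t ht2) hx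
    have h3 : 2 * (b - a) * (∫ z in a..b, (ux z t)^2) ≤ 2 * (b - a) * Y := by
      have := (hY t ht).1
      gcongr
    have h4 : 2 * (b - a) * (∫ z in a..b, (vx z t)^2) ≤ 2 * (b - a) * Y := by
      have := (hY t ht).2
      gcongr
    constructor
    · nlinarith [sq_nonneg (u x t - 1)]
    · nlinarith [sq_nonneg (v x t - 1)]

lemma Sys.mass_step (h : Sys a b χ M c u ux uxx ut v vx vxx vt B1 B2) (hδ : 0 < δ)
    (low : ∀ t, 2 ≤ t → ∀ x ∈ Icc a b, δ ≤ v x t) {t : ℝ} (ht : 2 ≤ t) :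
    (∫ x in a..b, u x (t + 1)) ≤ Real.exp (-δ) * (∫ x in a..b, u x t)
      + ∫ s in t..(t + 1), ∫ x in a..b, B1 x s := by
  have hab := h.hab
  have ht0 : 0 < t := by linarith
  have hβ : ∀ s, 0 < s → ContinuousAt (fun s => ∫ x in a..b, B1 x s) s :=
    fun s hs => cont_int hab h.b1c hs
  have hβ0 : ∀ s, 0 ≤ ∫ x in a..b, B1 x s := fun s => int_nonneg hab fun x _ => h.b1n x s
  have hβc : ContinuousOn (fun s => ∫ x in a..b, B1 x s) (Ioi 0) :=
    fun s hs => (hβ s hs).continuousWithinAt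
  have hintg : ∀ r, t ≤ r → IntervalIntegrable (fun s => ∫ x in a..b, B1 x s) volume t r := by
    intro r hr
    apply ContinuousOn.intervalIntegrable
    rw [uIcc_of_le hr]
    exact hβc.mono fun s hs => lt_of_lt_of_le ht0 hs.1
  have hΓ : ∀ r, t ≤ r → HasDerivAt (fun r => ∫ s in t..r, ∫ x in a..b, B1 x s)
      (∫ x in a..b, B1 x r) r := by
    intro r hr
    have hr0 : 0 < r := lt_of_lt_of_le ht0 hr
    exact intervalIntegral.integral_hasDerivAt_right (hintg r hr)
      (hβc.stronglyMeasurableAtFilter isOpen_Ioi r hr0) (hβ r hr0)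
  have hd : ∀ r ∈ Icc t (t + 1), HasDerivAt
      (fun r => Real.exp (δ * (r - (t + 1))) * (∫ x in a..b, u x r)
        - ∫ s in t..r, ∫ x in a..b, B1 x s)
      ((Real.exp (δ * (r - (t + 1))) * δ) * (∫ x in a..b, u x r)
        + Real.exp (δ * (r - (t + 1))) * ((∫ x in a..b, B1 x r) - ∫ x in a..b, u x r * v x r)
        - ∫ x in a..b, B1 x r) r := by
    intro r hr
    have hr0 : 0 < r := lt_of_lt_of_le ht0 hr.1
    have e1 : HasDerivAt (fun r => Real.exp (δ * (r - (t + 1))))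
        (Real.exp (δ * (r - (t + 1))) * δ) r := by
      have := (((hasDerivAt_id r).sub_const (t + 1)).const_mul δ).exp
      simpa using this
    exact (e1.mul (h.mass_u hr0)).sub (hΓ r hr.1)
  have key := anti (by linarith : t ≤ t + 1) hd (fun r hr => by
    have hr0 : 0 < r := lt_of_lt_of_le ht0 hr.1
    have h1 := h.uv_ge hr0 (low r (ht.trans hr.1))
    have h2 : Real.exp (δ * (r - (t + 1))) ≤ 1 := by
      rw [Real.exp_le_one_iff]
      have := hr.2
      nlinarith
    have h3 := Real.exp_pos (δ * (r - (t + 1)))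
    have h4 := mul_le_mul_of_nonneg_left h1 h3.le
    have h5 := mul_le_mul_of_nonneg_right h2 (hβ0 r)
    linarith)
  have e2 : δ * (t + 1 - (t + 1)) = 0 := by ring
  have e3 : δ * (t - (t + 1)) = -δ := by ring
  simp only [e2, e3, Real.exp_zero, intervalIntegral.integral_same] at key
  linarith

lemma decay_seq {U β : ℝ → ℝ} {q K T0 : ℝ} (hq0 : 0 ≤ q) (hq : q < 1) (hU0 : ∀ t, T0 ≤ t → 0 ≤ U t)
    (hU : ∀ t, T0 ≤ t → U t ≤ K) (hs : ∀ t, T0 ≤ t → U (t + 1) ≤ q * U t + β t)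
    (hβ : Tendsto β atTop (𝓝 0)) : Tendsto U atTop (𝓝 0) := by
  have hK : 0 ≤ K := (hU0 T0 le_rfl).trans (hU T0 le_rfl)
  rw [Metric.tendsto_atTop]
  intro ε hε
  have hε1 : 0 < ε / 2 * (1 - q) := mul_pos (by linarith) (by linarith)
  obtain ⟨T1, hT1⟩ := eventually_atTop.1 (hβ.eventually (gt_mem_nhds hε1))
  set T := max T0 T1 with hT
  have hTT0 : T0 ≤ T := le_max_left _ _
  have hTT1 : T1 ≤ T := le_max_right _ _
  have hind : ∀ n : ℕ, ∀ t, T + n ≤ t → U t ≤ ε / 2 + q ^ n * K := by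
    intro n
    induction n with
    | zero =>
      intro t ht
      have := hU t (by simp at ht; linarith)
      simp
      linarith
    | succ n ih =>
      intro t ht
      push_cast at ht
      have hn : (0:ℝ) ≤ n := Nat.cast_nonneg n
      have h1 := ih (t - 1) (by linarith)
      have h2 := hs (t - 1) (by linarith)
      have h3 := hT1 (t - 1) (by linarith)
      rw [sub_add_cancel] at h2
      have h4 := mul_le_mul_of_nonneg_left h1 hq0
      have h5 : q ^ (n + 1) * K = q * (q ^ n * K) := by ring
      rw [h5]
      linarith
  have hpow : Tendsto (fun n : ℕ => q ^ n * K) atTop (𝓝 0) := by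
    have := (tendsto_pow_atTop_nhds_zero_of_lt_one hq0 hq).mul_const K
    simpa using this
  obtain ⟨n, hn⟩ := (hpow.eventually (gt_mem_nhds (by linarith : (0:ℝ) < ε / 2))).exists
  refine ⟨T + n, fun t ht => ?_⟩
  have hn0 : (0:ℝ) ≤ n := Nat.cast_nonneg n
  have h1 := hind n t ht
  have h2 := hU0 t (by linarith)
  rw [Real.dist_eq, sub_zero, abs_of_nonneg h2]
  linarith

lemma Sys.decay (h : Sys a b χ M c u ux uxx ut v vx vxx vt B1 B2)
    (hB : Tendsto (fun t => ∫ s in t..(t + 1), ∫ x in a..b, B1 x s) atTop (𝓝 0)) :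
    ∀ ε, 0 < ε → ∃ T, 0 < T ∧ ∀ t, T ≤ t → ∀ x ∈ Icc a b, u x t < ε := by
  obtain ⟨δ, K, Y, C, hδ, hC, hK, hY0, low, mu, hsup, hY⟩ := h.sup_bdd
  have hab := h.hab
  have hL : 0 < b - a := sub_pos.2 hab
  have hUnn : ∀ t, 2 ≤ t → 0 ≤ ∫ x in a..b, u x t := fun t ht =>
    int_nonneg hab fun x hx => (h.up x hx t (by linarith)).le
  have hU : Tendsto (fun t => ∫ x in a..b, u x t) atTop (𝓝 0) :=
    decay_seq (T0 := 2) (K := K) (Real.exp_pos (-δ)).le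
      (by rw [Real.exp_lt_one_iff]; linarith) hUnn mu (fun t ht => h.mass_step hδ low ht) hB
  intro ε hε
  obtain ⟨η, hη0, hη⟩ : ∃ η : ℝ, 0 < η ∧ η * Y ≤ ε^2 / 4 := by
    refine ⟨ε^2 / (4 * (Y + 1)), by positivity, ?_⟩
    rw [div_mul_eq_mul_div, div_le_div_iff₀ (by positivity) (by positivity)]
    nlinarith [sq_nonneg ε]
  have hlim : Tendsto (fun t => C * ((∫ x in a..b, u x t) / (b - a))
      + C * (∫ x in a..b, u x t) / η) atTop (𝓝 0) := by
    have := (((hU.div_const (b - a)).const_mul C).add ((hU.const_mul C).div_const η))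
    simpa using this
  obtain ⟨T, hT⟩ := eventually_atTop.1 (hlim.eventually
    (gt_mem_nhds (by positivity : 0 < ε^2 / 4)))
  refine ⟨max T 4, by positivity, fun t ht x hx => ?_⟩
  have hTt : T ≤ t := (le_max_left _ _).trans ht
  have h4 : 4 ≤ t := (le_max_right _ _).trans ht
  have ht0 : 0 < t := by linarith
  have c0 := slice h.ru.c ht0
  have c1 := slice h.ru.cx ht0
  obtain ⟨z, hz, hzm⟩ := exists_le_mean hab c0
  have h1 := osc_le hab (f := fun x => u x t ^ 2) (f' := fun x => 2 * u x t * ux x t)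
    (fun x hx => by simpa using (h.ru.dx x hx t ht0).fun_pow 2) (by fun_prop) hx hz
  have h2 : ∫ z in a..b, |2 * u z t * ux z t|
      ≤ ∫ z in a..b, (C / η * u z t + η * (ux z t)^2) := by
    refine int_mono hab (by fun_prop) (by fun_prop) fun y hy => ?_
    have hu0 := (h.up y hy t ht0).le
    have huC := (hsup t h4 y hy).1
    have k1 : |2 * u y t * ux y t| ≤ u y t ^ 2 / η + η * (ux y t)^2 := by
      have k2 : u y t ^ 2 / η + η * (ux y t)^2 - 2 * u y t * ux y t
          = (u y t - η * ux y t)^2 / η := by field_simp; ring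
      have k3 : u y t ^ 2 / η + η * (ux y t)^2 + 2 * u y t * ux y t
          = (u y t + η * ux y t)^2 / η := by field_simp; ring
      have k4 : 0 ≤ (u y t - η * ux y t)^2 / η := by positivity
      have k5 : 0 ≤ (u y t + η * ux y t)^2 / η := by positivity
      rw [abs_le]
      constructor <;> linarith
    have k6 : u y t ^ 2 / η ≤ C / η * u y t := by
      rw [div_mul_eq_mul_div]
      gcongr
      nlinarith
    linarith
  rw [int_lin hab c0 (by fun_prop)] at h2
  have h3 : u z t ^ 2 ≤ C * ((∫ x in a..b, u x t) / (b - a)) := by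
    have k1 : u z t ≤ (∫ x in a..b, u x t) / (b - a) := by
      rw [le_div_iff₀ hL]
      linarith
    have hu0 := (h.up z hz t ht0).le
    have huC := (hsup t h4 z hz).1
    nlinarith
  have h5 := hT t hTt
  have h6 : η * (∫ z in a..b, (ux z t)^2) ≤ η * Y := by
    have := hY t h4
    gcongr
  have h7 : C / η * (∫ x in a..b, u x t) = C * (∫ x in a..b, u x t) / η := by ring
  have h8 : u x t ^ 2 < ε ^ 2 := by
    have : 0 < ε^2 := by positivity
    linarith
  exact lt_of_pow_lt_pow_left₀ 2 hε.le h8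
end

lemma holder_cont {a b : ℝ} {B : ℝ → ℝ → ℝ} (hB : HypB a b B) :
    ContinuousOn (fun p : ℝ × ℝ => B p.1 p.2) (Icc a b ×ˢ Ici 0) := by
  obtain ⟨-, -, ϑ, hϑ, hh⟩ := hB
  intro p hp
  set S : Set (ℝ × ℝ) := Icc a b ×ˢ Icc 0 (p.2 + 1) with hS
  have hp2 : (0:ℝ) ≤ p.2 := hp.2
  obtain ⟨C, hC⟩ := hh S (isCompact_Icc.prod isCompact_Icc) (prod_mono le_rfl fun s hs => hs.1)
  have hpS : p ∈ S := ⟨hp.1, hp2, by linarith⟩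
  have hev : ∀ᶠ q in 𝓝[Icc a b ×ˢ Ici 0] p, q ∈ S := by
    have h1 : ∀ᶠ q : ℝ × ℝ in 𝓝[Icc a b ×ˢ Ici 0] p, q.2 < p.2 + 1 :=
      (continuousAt_snd.eventually (gt_mem_nhds (by linarith : p.2 < p.2 + 1))).filter_mono
        nhdsWithin_le_nhds
    filter_upwards [h1, self_mem_nhdsWithin] with q h1 h2
    exact ⟨h2.1, h2.2, h1.le⟩
  have hlim : Tendsto (fun q : ℝ × ℝ => C * dist q p ^ ϑ) (𝓝[Icc a b ×ˢ Ici 0] p) (𝓝 0) := by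
    have h1 : Tendsto (fun q : ℝ × ℝ => dist q p) (𝓝 p) (𝓝 0) := by
      have : Continuous (fun q : ℝ × ℝ => dist q p) := by fun_prop
      simpa using this.tendsto p
    have h2 := (h1.rpow_const (p := ϑ) (Or.inr hϑ.1.le)).const_mul C
    rw [Real.zero_rpow hϑ.1.ne', mul_zero] at h2
    exact h2.mono_left nhdsWithin_le_nhds
  rw [ContinuousWithinAt, tendsto_iff_dist_tendsto_zero]
  refine squeeze_zero' (Eventually.of_forall fun q => dist_nonneg) ?_ hlim
  filter_upwards [hev] with q hq
  rw [Real.dist_eq]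
  exact hC q hq p hpS

lemma mem_It {t : ℝ} (ht : 0 ≤ t) : t ∈ It ⊤ := ⟨ht, ENNReal.ofReal_lt_top⟩

lemma mem_It' {t : ℝ} (ht : 0 < t) : t ∈ It' ⊤ := ⟨ht, ENNReal.ofReal_lt_top⟩

lemma eq_Icc {a b : ℝ} (hab : a < b) {f g : ℝ → ℝ} (hf : ContinuousOn f (Icc a b))
    (hg : ContinuousOn g (Icc a b)) (h : ∀ x ∈ Ioo a b, f x = g x) : ∀ x ∈ Icc a b, f x = g x := by
  have : EqOn f g (Icc a b) :=
    EqOn.of_subset_closure (s := Ioo a b) h hf hg Ioo_subset_Icc_self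
      (by rw [closure_Ioo hab.ne])
  exact this

lemma int_Ioo {a b : ℝ} (hab : a < b) (f : ℝ → ℝ) : ∫ x in Ioo a b, f x = ∫ x in a..b, f x := by
  rw [intervalIntegral.integral_of_le hab.le, integral_Ioc_eq_integral_Ioo]

lemma mkSys {a b χ : ℝ} (hab : a < b) (hχ : 0 < χ)
    {B1 B2 : ℝ → ℝ → ℝ} (hB1 : HypB a b B1) (hB2 : HypB a b B2)
    {u0 v0 : ℝ → ℝ} {u v : ℝ → ℝ → ℝ} (hs : CrimeSol a b χ B1 B2 u0 v0 u v ⊤)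
    (hH2 : HypH2 a b B2) :
    ∃ M c, Sys a b χ M c u (pdx u) (pdx (pdx u)) (pdt u) v (pdx v) (pdx (pdx v)) (pdt v) B1 B2 := by
  obtain ⟨c, hc, hc2⟩ := hH2
  obtain ⟨M1, hM1⟩ := hB1.2.1
  obtain ⟨M2, hM2⟩ := hB2.2.1
  have sub : Icc a b ×ˢ Ioi (0:ℝ) ⊆ Icc a b ×ˢ Ici 0 := prod_mono le_rfl Ioi_subset_Ici_self
  have subI : Icc a b ×ˢ Ioi (0:ℝ) ⊆ Icc a b ×ˢ It ⊤ :=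
    prod_mono le_rfl fun t ht => mem_It (le_of_lt ht)
  have subI' : Icc a b ×ˢ Ioi (0:ℝ) ⊆ Icc a b ×ˢ It' ⊤ :=
    prod_mono le_rfl fun t ht => mem_It' ht
  have ru : Reg a b u (pdx u) (pdx (pdx u)) (pdt u) :=
    { c := hs.u_cont.mono subI
      cx := (hs.u_cont21.mono subI').fst
      cxx := (hs.u_cont21.mono subI').snd.fst
      ct := (hs.u_cont21.mono subI').snd.snd
      dx := fun x hx t ht => (hs.u_reg x hx t (mem_It' ht)).1.hasDerivAt
      dxx := fun x hx t ht => (hs.u_reg x hx t (mem_It' ht)).2.1.hasDerivAt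
      dt := fun x hx t ht => (hs.u_reg x hx t (mem_It' ht)).2.2.hasDerivAt
      ba := fun t ht => (hs.u_bc t (mem_It' ht)).1
      bb := fun t ht => (hs.u_bc t (mem_It' ht)).2 }
  have rv : Reg a b v (pdx v) (pdx (pdx v)) (pdt v) :=
    { c := hs.v_cont.mono subI
      cx := (hs.v_cont21.mono subI').fst
      cxx := (hs.v_cont21.mono subI').snd.fst
      ct := (hs.v_cont21.mono subI').snd.snd
      dx := fun x hx t ht => (hs.v_reg x hx t (mem_It' ht)).1.hasDerivAt
      dxx := fun x hx t ht => (hs.v_reg x hx t (mem_It' ht)).2.1.hasDerivAt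
      dt := fun x hx t ht => (hs.v_reg x hx t (mem_It' ht)).2.2.hasDerivAt
      ba := fun t ht => (hs.v_bc t (mem_It' ht)).1
      bb := fun t ht => (hs.v_bc t (mem_It' ht)).2 }
  have b1c := (holder_cont hB1).mono sub
  have b2c := (holder_cont hB2).mono sub
  refine ⟨max M1 M2, c,
    { hab := hab, hχ := hχ, hc := hc, ru := ru, rv := rv
      up := fun x hx t ht => hs.u_pos x hx t (mem_It' ht)
      vp := fun x hx t ht => hs.v_pos x hx t (mem_It' ht)
      b1c := b1c, b2c := b2c, b1n := hB1.1, b2n := hB2.1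
      b1m := fun x t => (hM1 x t).trans (le_max_left _ _)
      b2m := fun x t => (hM2 x t).trans (le_max_right _ _)
      b2l := fun t ht => by
        rw [← int_Ioo hab]
        exact hc2 t ht
      ueq := ?_
      veq := ?_ }⟩
  · intro x hx t ht
    have s1 := slice ru.c ht
    have s2 := slice ru.cx ht
    have s3 := slice ru.cxx ht
    have s4 := slice ru.ct ht
    have s5 := slice rv.c ht
    have s6 := slice rv.cx ht
    have s7 := slice rv.cxx ht
    have s8 := slice b1c ht
    have z : ∀ x ∈ Icc a b, v x t ≠ 0 := fun x hx => (hs.v_pos x hx t (mem_It' ht)).ne'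
    revert x
    refine eq_Icc hab s4 (by fun_prop (disch := assumption)) fun x hx => ?_
    have hx' := Ioo_subset_Icc_self hx
    rw [hs.u_eq x hx t (mem_It' ht)]
    have hz := z x hx'
    have hd := ((ru.dx x hx' t ht).fun_div (rv.dx x hx' t ht) hz).fun_mul (rv.dxx x hx' t ht)
    have he : pdx (fun y s => u y s / v y s * pdx v y s) x t = _ := hd.deriv
    rw [he]
    field_simp
    ring
  · intro x hx t ht
    have s1 := slice ru.c ht
    have s4 := slice rv.ct ht
    have s5 := slice rv.c ht
    have s6 := slice rv.cx ht
    have s7 := slice rv.cxx ht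
    have s8 := slice b2c ht
    revert x
    exact eq_Icc hab s4 (by fun_prop) fun x hx => hs.v_eq x hx t (mem_It' ht)

end CrimeAux

/-- Theorem 1.2 (boundedness under (H2), and decay of `u` under (H1')). -/
theorem boundedness_and_decay_crime_model
    (a b χ : ℝ) (hab : a < b) (hχ : 0 < χ)
    (B1 B2 : ℝ → ℝ → ℝ) (hB1 : HypB a b B1) (hB2 : HypB a b B2)
    (u0 v0 : ℝ → ℝ) (hinit : HypInit a b u0 v0)
    (u v : ℝ → ℝ → ℝ) (hsol : CrimeSol a b χ B1 B2 u0 v0 u v ⊤)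
    (hH2 : HypH2 a b B2) :
    (∃ C : ℝ, 0 < C ∧
      (∀ x ∈ Set.Ioo a b, ∀ t : ℝ, 0 < t → u x t ≤ C) ∧
      (∀ x ∈ Set.Ioo a b, ∀ t : ℝ, 0 < t → 1 / C ≤ v x t ∧ v x t ≤ C)) ∧
    (HypH1' a b B1 →
      TendstoUniformlyOn (fun (t : ℝ) (x : ℝ) => u x t) (fun _ => 0)
        Filter.atTop (Set.Ioo a b)) := by
  obtain ⟨M, c, h⟩ := CrimeAux.mkSys hab hχ hB1 hB2 hsol hH2
  constructor
  · obtain ⟨δ, K, Y, C, hδ, hC, hK, hY0, low, mu, hsup, hY⟩ := h.sup_bdd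
    have hcomp : IsCompact (Icc a b ×ˢ Icc (0:ℝ) 4) := isCompact_Icc.prod isCompact_Icc
    have hsub : Icc a b ×ˢ Icc (0:ℝ) 4 ⊆ Icc a b ×ˢ It ⊤ :=
      prod_mono le_rfl fun t ht => CrimeAux.mem_It ht.1
    have hne : (Icc a b ×ˢ Icc (0:ℝ) 4).Nonempty :=
      ⟨(a, 0), left_mem_Icc.2 hab.le, left_mem_Icc.2 (by norm_num)⟩
    obtain ⟨Cu, hCu⟩ := hcomp.exists_bound_of_continuousOn (hsol.u_cont.mono hsub)
    obtain ⟨Cv, hCv⟩ := hcomp.exists_bound_of_continuousOn (hsol.v_cont.mono hsub)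
    obtain ⟨p, hp, hmin⟩ := hcomp.exists_isMinOn hne (hsol.v_cont.mono hsub)
    have hm0 : 0 < v p.1 p.2 := by
      rcases eq_or_lt_of_le hp.2.1 with h0 | h0
      · rw [← h0, hsol.v_init p.1 hp.1]
        exact hinit.2.2.2 p.1 hp.1
      · exact hsol.v_pos p.1 hp.1 p.2 (CrimeAux.mem_It' h0)
    set m := min δ (v p.1 p.2) with hm
    have hmpos : 0 < m := lt_min hδ hm0
    have hCu' : ∀ x ∈ Ioo a b, ∀ t : ℝ, 0 < t → t ≤ 4 → u x t ≤ |Cu| := fun x hx t h0 h4 =>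
      (le_abs_self _).trans ((hCu (x, t) ⟨Ioo_subset_Icc_self hx, h0.le, h4⟩).trans (le_abs_self _))
    have hCv' : ∀ x ∈ Ioo a b, ∀ t : ℝ, 0 < t → t ≤ 4 → v x t ≤ |Cv| := fun x hx t h0 h4 =>
      (le_abs_self _).trans ((hCv (x, t) ⟨Ioo_subset_Icc_self hx, h0.le, h4⟩).trans (le_abs_self _))
    have hvm : ∀ x ∈ Ioo a b, ∀ t : ℝ, 0 < t → m ≤ v x t := by
      intro x hx t ht
      rcases le_total t 4 with h4 | h4
      · exact (min_le_right _ _).trans (hmin (a := (x, t)) ⟨Ioo_subset_Icc_self hx, ht.le, h4⟩)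
      · exact (min_le_left _ _).trans (low t (by linarith) x (Ioo_subset_Icc_self hx))
    have hm1 : 0 < 1 / m := by positivity
    have n1 := abs_nonneg Cu
    have n2 := abs_nonneg Cv
    have hCpos : 0 < C + |Cu| + |Cv| + 1 / m := by positivity
    refine ⟨C + |Cu| + |Cv| + 1 / m, hCpos, ?_, ?_⟩
    · intro x hx t ht
      rcases le_total t 4 with h4 | h4
      · linarith [hCu' x hx t ht h4]
      · linarith [(hsup t h4 x (Ioo_subset_Icc_self hx)).1]
    · intro x hx t ht
      constructor
      · refine le_trans ?_ (hvm x hx t ht)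
        rw [one_div_le hCpos hmpos]
        linarith
      · rcases le_total t 4 with h4 | h4
        · linarith [hCv' x hx t ht h4]
        · linarith [(hsup t h4 x (Ioo_subset_Icc_self hx)).2]
  · intro hH1
    have hB : Tendsto (fun t => ∫ s in t..(t + 1), ∫ x in a..b, B1 x s) atTop (𝓝 0) := by
      have h1 := hH1
      unfold HypH1' at h1
      simpa only [CrimeAux.int_Ioo hab] using h1
    rw [Metric.tendstoUniformlyOn_iff]
    intro ε hε
    obtain ⟨T, hT0, hT⟩ := h.decay hB ε hε
    filter_upwards [eventually_ge_atTop T] with t ht x hx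
    have hx' := Ioo_subset_Icc_self hx
    have hpos := h.up x hx' t (hT0.trans_le ht)
    rw [dist_comm, Real.dist_eq, sub_zero, abs_of_pos hpos]
    exact hT t ht x hx'
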